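/- arXiv:2212.14500 — 2 statements merged into one kernel-verified Lean document; each statement's English description precedes it below -/
import Mathlib

section
/- Let J = [t₀, t₀ + a] with a > 0, let g : J → ℝ be nondecreasing and left-continuous, and let h, f : J × ℝⁿ → ℝⁿ with f satisfying (A0) and (A1). For each k ∈ ℕ let h_k, f_k : J × ℝⁿ → ℝⁿ satisfy conditions (A0)–(A3) with associated D-functions φ_k and bound functions M_k, and assume: (I) for every 0 < c < d there is δ > 0 with φ_k(t) < t − δ for all t ∈ [c,d] and all k; (i) x̂_k → x₀ in ℝⁿ; (ii) h_k(t,u) → h(t,u) as k → ∞ uniformly for t ∈ J and u in bounded subsets of ℝⁿ; (iii) f_k(t,u) → f(t,u) as k → ∞ for each t ∈ J, uniformly for u in bounded subsets of ℝⁿ; the sequence (M_k)_k converges pointwise on J; and there exists C > 0 such that for every subdivision t₀ = σ₀ < σ₁ < ⋯ < σ_l = t₀ + a of J and every finite subset {m₁,…,m_l} of ℕ one has ∑_{j=1}^{l} ∫_{σ_{j−1}}^{σ_j} M_{m_j}(s) dg(s) ≤ C. For each k let x_k : J → ℝⁿ be a solution of the hybrid measure differential equation on J with data (h_k, f_k,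 g, x̂_k). If there exists R > 0 with liminf_{k→∞} sup_{r ≥ R} φ_k(r)/r < 1, then there is a subsequence of (x_k)_k converging uniformly on J to a solution x of the hybrid measure differential equation on J with data (h, f, g, x₀). -/
open Set Filter Topology

namespace HMDEPaper

/-- `ℝⁿ` with the Euclidean norm. -/
abbrev En (n : ℕ) := EuclideanSpace ℝ (Fin n)

section Defs

variable {E : Type*} [NormedAddCommGroup E]

/-- `f` is regulated on the interval `[a, b]`: one-sided limits exist at every point. -/
def RegulatedOn (f : ℝ → E) (a b : ℝ) : Prop :=
  (∀ t ∈ Set.Ioc a b, ∃ L, Filter.Tendsto f (nhdsWithin t (Set.Ico a t)) (nhds L)) ∧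
  (∀ t ∈ Set.Ico a b, ∃ L, Filter.Tendsto f (nhdsWithin t (Set.Ioc t b)) (nhds L))

/-- `f` is regulated on `[0, ∞)`: one-sided limits exist at every point. -/
def RegulatedOnIci (f : ℝ → E) : Prop :=
  (∀ t : ℝ, 0 < t → ∃ L, Filter.Tendsto f (nhdsWithin t (Set.Ico 0 t)) (nhds L)) ∧
  (∀ t : ℝ, 0 ≤ t → ∃ L, Filter.Tendsto f (nhdsWithin t (Set.Ioi t)) (nhds L))

/-- A family `F` of functions is equiregulated on `[a, b]`. -/
def EquiregulatedOn (F : Set (ℝ → E)) (a b : ℝ) : Prop :=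
  ∀ ε : ℝ, 0 < ε →
    (∀ τ ∈ Set.Ioc a b, ∃ δ > (0 : ℝ), ∀ y ∈ F, ∀ L,
      Filter.Tendsto y (nhdsWithin τ (Set.Ico a τ)) (nhds L) →
      ∀ t ∈ Set.Ico a τ, τ - δ < t → ‖y t - L‖ < ε) ∧
    (∀ τ ∈ Set.Ico a b, ∃ δ > (0 : ℝ), ∀ y ∈ F, ∀ L,
      Filter.Tendsto y (nhdsWithin τ (Set.Ioc τ b)) (nhds L) →
      ∀ t ∈ Set.Ioc τ b, t < τ + δ → ‖y t - L‖ < ε)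

/-- A D-function: continuous, nondecreasing on `[0, ∞)`, vanishing at `0`, positive on `(0, ∞)`. -/
def IsDFunction (φ : ℝ → ℝ) : Prop :=
  ContinuousOn φ (Set.Ici 0) ∧ MonotoneOn φ (Set.Ici 0) ∧ φ 0 = 0 ∧
    ∀ s : ℝ, 0 < s → 0 < φ s

/-- `g` is left-continuous at every point of `(a, b]`. -/
def LeftContinuousOn (g : ℝ → ℝ) (a b : ℝ) : Prop :=
  ∀ t ∈ Set.Ioc a b, Filter.Tendsto g (nhdsWithin t (Set.Ico a t)) (nhds (g t))

/-- A bounded regulated function on `[0, ∞)` which is S-asymptotically `ω`-periodic. -/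
def SAsympPeriodic (ω : ℝ) (x : ℝ → E) : Prop :=
  (∃ C : ℝ, ∀ t : ℝ, 0 ≤ t → ‖x t‖ ≤ C) ∧ RegulatedOnIci x ∧
    Filter.Tendsto (fun t => x (t + ω) - x t) Filter.atTop (nhds 0)

end Defs

section KS

/-- A tagged partition of `[a, b]`. -/
structure TaggedPartition (a b : ℝ) where
  n : ℕ
  npos : 0 < n
  s : ℕ → ℝ
  τ : ℕ → ℝ
  s_first : s 0 = a
  s_last : s n = b
  s_mono : ∀ i < n, s i ≤ s (i + 1)
  tag_mem : ∀ i < n, τ i ∈ Set.Icc (s i) (s (i + 1))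

/-- A tagged partition is `δ`-fine for a gauge `δ`. -/
def TaggedPartition.IsFine {a b : ℝ} (P : TaggedPartition a b) (δ : ℝ → ℝ) : Prop :=
  ∀ i < P.n,
    Set.Icc (P.s i) (P.s (i + 1)) ⊆ Set.Ioo (P.τ i - δ (P.τ i)) (P.τ i + δ (P.τ i))

variable {E : Type*} [NormedAddCommGroup E] [NormedSpace ℝ E]

/-- The Kurzweil–Stieltjes Riemann sum of `f` w.r.t. `g` over a tagged partition. -/
def TaggedPartition.sum {a b : ℝ} (P : TaggedPartition a b) (f : ℝ → E) (g : ℝ → ℝ) : E :=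
  ∑ i ∈ Finset.range P.n, (g (P.s (i + 1)) - g (P.s i)) • f (P.τ i)

/-- `I` is the Kurzweil–Stieltjes integral of `f` w.r.t. `g` over `[a, b]`. -/
def HasKSIntegral (f : ℝ → E) (g : ℝ → ℝ) (a b : ℝ) (I : E) : Prop :=
  ∀ ε : ℝ, 0 < ε → ∃ δ : ℝ → ℝ, (∀ t, 0 < δ t) ∧
    ∀ P : TaggedPartition a b, P.IsFine δ → ‖P.sum f g - I‖ < ε

/-- `f` is Kurzweil–Stieltjes integrable w.r.t. `g` over `[a, b]`. -/
def KSIntegrable (f : ℝ → E) (g : ℝ → ℝ) (a b : ℝ) : Prop :=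
  ∃ I, HasKSIntegral f g a b I

/-- A solution of the hybrid measure differential equation on `[t₀, t₀ + a]`
with data `(h, f, g, x₀)`. -/
def IsHMDESolution (h f : ℝ → E → E) (g : ℝ → ℝ) (t₀ a : ℝ) (x₀ : E) (x : ℝ → E) : Prop :=
  RegulatedOn x t₀ (t₀ + a) ∧ x t₀ = x₀ ∧
  RegulatedOn (fun t => h t (x t)) t₀ (t₀ + a) ∧
  ∃ I : ℝ → E,
    (∀ t ∈ Set.Icc t₀ (t₀ + a), HasKSIntegral (fun s => f s (x s)) g t₀ t (I t)) ∧
    (∀ t ∈ Set.Icc t₀ (t₀ + a), x t = x₀ - h t₀ x₀ + h t (x t) + I t)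

end KS

end HMDEPaper

namespace HMDEPaper

section FineSums

variable {E : Type*} [NormedAddCommGroup E] [NormedSpace ℝ E]

/-- `v` is the Riemann sum of `H` with respect to `g` over some `δ`-fine tagged partition
of `[c, d]`. -/
def IsFineSum (H : ℝ → E) (g δ : ℝ → ℝ) (c d : ℝ) (v : E) : Prop :=
  ∃ P : TaggedPartition c d, P.IsFine δ ∧ P.sum H g = v

lemma hasKSIntegral_iff {H : ℝ → E} {g : ℝ → ℝ} {c d : ℝ} {I : E} :
    HasKSIntegral H g c d I ↔ ∀ ε : ℝ, 0 < ε → ∃ δ : ℝ → ℝ, (∀ t, 0 < δ t) ∧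
      ∀ v, IsFineSum H g δ c d v → ‖v - I‖ < ε := by
  constructor
  · intro h ε hε
    obtain ⟨δ, h1, h2⟩ := h ε hε
    exact ⟨δ, h1, by rintro _ ⟨P, hP, rfl⟩; exact h2 P hP⟩
  · intro h ε hε
    obtain ⟨δ, h1, h2⟩ := h ε hε
    exact ⟨δ, h1, fun P hP => h2 _ ⟨P, hP, rfl⟩⟩

lemma IsFineSum.mono {H : ℝ → E} {g δ δ' : ℝ → ℝ} {c d : ℝ} {v : E}
    (h : IsFineSum H g δ c d v) (hδ : ∀ t, δ t ≤ δ' t) : IsFineSum H g δ' c d v := by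
  obtain ⟨P, hP, hv⟩ := h
  refine ⟨P, fun i hi => (hP i hi).trans (Ioo_subset_Ioo ?_ ?_), hv⟩
  · linarith [hδ (P.τ i)]
  · linarith [hδ (P.τ i)]

lemma IsFineSum.single {H : ℝ → E} {g δ : ℝ → ℝ} {c d τ : ℝ} (hτ : τ ∈ Icc c d)
    (h : Icc c d ⊆ Ioo (τ - δ τ) (τ + δ τ)) :
    IsFineSum H g δ c d ((g d - g c) • H τ) := by
  refine ⟨⟨1, one_pos, fun i => if i = 0 then c else d, fun _ => τ, by simp, by simp, ?_, ?_⟩,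
    ?_, ?_⟩
  · intro i hi
    obtain rfl : i = 0 := by omega
    simpa using hτ.1.trans hτ.2
  · intro i hi
    obtain rfl : i = 0 := by omega
    simpa using hτ
  · intro i hi
    obtain rfl : i = 0 := by
      change i < 1 at hi
      omega
    simpa using h
  · simp [TaggedPartition.sum]

lemma IsFineSum.append {H : ℝ → E} {g δ : ℝ → ℝ} {c d e : ℝ} {v w : E}
    (hv : IsFineSum H g δ c d v) (hw : IsFineSum H g δ d e w) :
    IsFineSum H g δ c e (v + w) := by
  obtain ⟨P, hP, rfl⟩ := hv
  obtain ⟨Q, hQ, rfl⟩ := hw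
  have key : ∀ i, ∀ p : ℝ → ℝ → ℝ → Prop,
      (∀ i < P.n, p (P.s i) (P.s (i + 1)) (P.τ i)) →
      (∀ i < Q.n, p (Q.s i) (Q.s (i + 1)) (Q.τ i)) → i < P.n + Q.n →
      p (if i ≤ P.n then P.s i else Q.s (i - P.n))
        (if i + 1 ≤ P.n then P.s (i + 1) else Q.s (i + 1 - P.n))
        (if i < P.n then P.τ i else Q.τ (i - P.n)) := by
    intro i p h1 h2 hi
    by_cases h : i < P.n
    · rw [if_pos h.le, if_pos (by omega), if_pos h]
      exact h1 i h
    · rw [if_neg (by omega : ¬ i + 1 ≤ P.n), if_neg h]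
      have h3 : (if i ≤ P.n then P.s i else Q.s (i - P.n)) = Q.s (i - P.n) := by
        split_ifs with h4
        · obtain rfl : i = P.n := by omega
          simp [P.s_last, Q.s_first]
        · rfl
      rw [h3, show i + 1 - P.n = i - P.n + 1 by omega]
      exact h2 _ (by omega)
  refine ⟨⟨P.n + Q.n, by have := P.npos; omega,
    fun i => if i ≤ P.n then P.s i else Q.s (i - P.n),
    fun i => if i < P.n then P.τ i else Q.τ (i - P.n), by simp [P.s_first], ?_, ?_, ?_⟩, ?_, ?_⟩
  · have := Q.npos
    simp [show Q.n ≠ 0 by omega, Q.s_last]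
  · intro i hi
    exact key i (fun a b _ => a ≤ b) P.s_mono Q.s_mono hi
  · intro i hi
    exact key i (fun a b t => t ∈ Icc a b) P.tag_mem Q.tag_mem hi
  · intro i hi
    exact key i (fun a b t => Icc a b ⊆ Ioo (t - δ t) (t + δ t)) hP hQ hi
  · simp only [TaggedPartition.sum]
    rw [Finset.sum_range_add]
    congr 1
    · refine Finset.sum_congr rfl fun i hi => ?_
      have hi := Finset.mem_range.1 hi
      rw [if_pos hi.le, if_pos (by omega : i + 1 ≤ P.n), if_pos hi]
    · refine Finset.sum_congr rfl fun i hi => ?_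
      have hi := Finset.mem_range.1 hi
      rw [if_neg (by omega : ¬ P.n + i + 1 ≤ P.n), if_neg (by omega : ¬ P.n + i < P.n)]
      have h3 : (if P.n + i ≤ P.n then P.s (P.n + i) else Q.s (P.n + i - P.n)) = Q.s i := by
        split_ifs with h4
        · obtain rfl : i = 0 := by omega
          simp [P.s_last, Q.s_first]
        · simp
      rw [h3, show P.n + i + 1 - P.n = i + 1 by omega, show P.n + i - P.n = i by omega]

/-- Cousin's lemma. -/
lemma exists_isFineSum (H : ℝ → E) (g : ℝ → ℝ) {δ : ℝ → ℝ} (hδ : ∀ t, 0 < δ t) {c d : ℝ}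
    (hcd : c ≤ d) : ∃ v, IsFineSum H g δ c d v := by
  set S : Set ℝ := {x | x ∈ Icc c d ∧ ∃ v, IsFineSum H g δ c x v} with hS
  have hcS : c ∈ S := ⟨⟨le_rfl, hcd⟩, _, IsFineSum.single (τ := c) ⟨le_rfl, le_rfl⟩ (by
    intro y hy
    obtain rfl : y = c := le_antisymm hy.2 hy.1
    exact ⟨by linarith [hδ y], by linarith [hδ y]⟩)⟩
  have hbdd : BddAbove S := ⟨d, fun x hx => hx.1.2⟩
  set σ := sSup S with hσ
  have hcσ : c ≤ σ := le_csSup hbdd hcS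
  have hσd : σ ≤ d := csSup_le ⟨c, hcS⟩ fun x hx => hx.1.2
  obtain ⟨x, hxS, hx⟩ := exists_lt_of_lt_csSup ⟨c, hcS⟩ (show σ - δ σ < sSup S by
    linarith [hδ σ])
  have hxσ : x ≤ σ := le_csSup hbdd hxS
  obtain ⟨⟨hcx, hxd⟩, v, hv⟩ := hxS
  have ext : ∀ y, σ ≤ y → y < σ + δ σ → ∃ v, IsFineSum H g δ c y v := fun y h1 h2 =>
    ⟨_, hv.append (IsFineSum.single (τ := σ) ⟨hxσ, h1⟩ fun z hz =>
      ⟨lt_of_lt_of_le hx hz.1, lt_of_le_of_lt hz.2 h2⟩)⟩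
  rcases hσd.eq_or_lt with h | h
  · rw [← h]
    exact ext σ le_rfl (by linarith [hδ σ])
  · exfalso
    have hy1 : σ < min d (σ + δ σ / 2) := lt_min h (by linarith [hδ σ])
    have : min d (σ + δ σ / 2) ∈ S := ⟨⟨hcσ.trans hy1.le, min_le_left _ _⟩,
      ext _ hy1.le (lt_of_le_of_lt (min_le_right _ _) (by linarith [hδ σ]))⟩
    exact absurd (le_csSup hbdd this) (not_le.2 hy1)

lemma HasKSIntegral.unique {H : ℝ → E} {g : ℝ → ℝ} {c d : ℝ} {I I' : E} (hcd : c ≤ d)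
    (h : HasKSIntegral H g c d I) (h' : HasKSIntegral H g c d I') : I = I' := by
  rw [← sub_eq_zero, ← norm_le_zero_iff]
  refine le_of_forall_pos_le_add fun ε hε => ?_
  obtain ⟨δ, h1, h2⟩ := hasKSIntegral_iff.1 h (ε / 2) (by linarith)
  obtain ⟨δ', h1', h2'⟩ := hasKSIntegral_iff.1 h' (ε / 2) (by linarith)
  obtain ⟨v, hv⟩ := exists_isFineSum H g (δ := fun t => min (δ t) (δ' t))
    (fun t => lt_min (h1 t) (h1' t)) hcd
  have e1 := h2 v (hv.mono fun t => min_le_left _ _)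
  have e2 := h2' v (hv.mono fun t => min_le_right _ _)
  have : I - I' = (v - I') - (v - I) := by abel
  rw [this]
  linarith [norm_sub_le (v - I') (v - I)]

lemma HasKSIntegral.append {H : ℝ → E} {g : ℝ → ℝ} {c d e : ℝ} {I J K : E} (hcd : c ≤ d)
    (hde : d ≤ e) (hI : HasKSIntegral H g c d I) (hJ : HasKSIntegral H g d e J)
    (hK : HasKSIntegral H g c e K) : K = I + J := by
  rw [← sub_eq_zero, ← norm_le_zero_iff]
  refine le_of_forall_pos_le_add fun ε hε => ?_
  obtain ⟨δ₁, p1, q1⟩ := hasKSIntegral_iff.1 hI (ε / 3) (by linarith)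
  obtain ⟨δ₂, p2, q2⟩ := hasKSIntegral_iff.1 hJ (ε / 3) (by linarith)
  obtain ⟨δ₃, p3, q3⟩ := hasKSIntegral_iff.1 hK (ε / 3) (by linarith)
  have hpos : ∀ t, 0 < min (δ₁ t) (min (δ₂ t) (δ₃ t)) :=
    fun t => lt_min (p1 t) (lt_min (p2 t) (p3 t))
  obtain ⟨v, hv⟩ := exists_isFineSum H g hpos hcd
  obtain ⟨w, hw⟩ := exists_isFineSum H g hpos hde
  have e1 := q1 v (hv.mono fun t => min_le_left _ _)
  have e2 := q2 w (hw.mono fun t => (min_le_right _ _).trans (min_le_left _ _))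
  have e3 := q3 _ ((hv.append hw).mono fun t => (min_le_right _ _).trans (min_le_right _ _))
  have : K - (I + J) = (v - I) + (w - J) - (v + w - K) := by abel
  rw [this]
  linarith [norm_sub_le ((v - I) + (w - J)) (v + w - K), norm_add_le (v - I) (w - J)]

/-- Integrability restricts to subintervals. -/
lemma KSIntegrable.mono [CompleteSpace E] {H : ℝ → E} {g : ℝ → ℝ} {A B c d : ℝ}
    (h : KSIntegrable H g A B) (hAc : A ≤ c) (hcd : c ≤ d) (hdB : d ≤ B) :
    KSIntegrable H g c d := by
  obtain ⟨I, hI⟩ := h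
  have cauchy : ∀ ε : ℝ, 0 < ε → ∃ δ : ℝ → ℝ, (∀ t, 0 < δ t) ∧
      ∀ v w, IsFineSum H g δ c d v → IsFineSum H g δ c d w → ‖v - w‖ < ε := by
    intro ε hε
    obtain ⟨δ, h1, h2⟩ := hasKSIntegral_iff.1 hI (ε / 2) (by linarith)
    obtain ⟨p, hp⟩ := exists_isFineSum H g h1 hAc
    obtain ⟨q, hq⟩ := exists_isFineSum H g h1 hdB
    refine ⟨δ, h1, fun v w hv hw => ?_⟩
    have e1 := h2 _ ((hp.append hv).append hq)
    have e2 := h2 _ ((hp.append hw).append hq)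
    have : v - w = (p + v + q - I) - (p + w + q - I) := by abel
    rw [this]
    linarith [norm_sub_le (p + v + q - I) (p + w + q - I)]
  choose! δ hδ hδ' using cauchy
  let u : ℕ → ℝ := fun n => 1 / ((n : ℝ) + 1)
  have hu : ∀ n, 0 < u n := fun n => Nat.one_div_pos_of_nat
  have ex : ∀ n m : ℕ, ∃ v, IsFineSum H g (fun t => min (δ (u n) t) (δ (u m) t)) c d v :=
    fun n m => exists_isFineSum H g
      (fun t => lt_min (hδ _ (hu n) t) (hδ _ (hu m) t)) hcd
  have ex1 : ∀ n : ℕ, ∃ v, IsFineSum H g (δ (u n)) c d v := fun n =>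
    exists_isFineSum H g (hδ _ (hu n)) hcd
  choose v hv using ex1
  have hdist : ∀ n m, ‖v n - v m‖ ≤ u n + u m := by
    intro n m
    obtain ⟨w, hw⟩ := ex n m
    have e1 := hδ' _ (hu n) _ _ (hv n) (hw.mono fun t => min_le_left _ _)
    have e2 := hδ' _ (hu m) _ _ (hw.mono fun t => min_le_right _ _) (hv m)
    have : v n - v m = (v n - w) + (w - v m) := by abel
    rw [this]
    linarith [norm_add_le (v n - w) (w - v m)]
  have hu0 : Tendsto u atTop (𝓝 0) := tendsto_one_div_add_atTop_nhds_zero_nat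
  have hcs : CauchySeq v := by
    refine Metric.cauchySeq_iff.2 fun ε hε => ?_
    obtain ⟨N, hN⟩ := eventually_atTop.1 (hu0.eventually (gt_mem_nhds (half_pos hε)))
    refine ⟨N, fun m hm n hn => ?_⟩
    rw [dist_eq_norm]
    linarith [hdist m n, hN m hm, hN n hn]
  obtain ⟨J, hJ⟩ := cauchySeq_tendsto_of_complete hcs
  refine ⟨J, hasKSIntegral_iff.2 fun ε hε => ?_⟩
  have e1 := hu0.eventually (gt_mem_nhds (half_pos hε))
  have e2 := Metric.tendsto_nhds.1 hJ (ε / 2) (half_pos hε)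
  obtain ⟨n, hn1, hn2⟩ := (e1.and e2).exists
  refine ⟨δ (u n), hδ _ (hu n), fun w hw => ?_⟩
  have e3 := hδ' _ (hu n) _ _ hw (hv n)
  rw [dist_eq_norm] at hn2
  have : w - J = (w - v n) + (v n - J) := by abel
  rw [this]
  linarith [norm_add_le (w - v n) (v n - J)]

/-- Fine sums over the pieces of a division add up to a fine sum. -/
lemma IsFineSum.sum_range {H : ℝ → E} {g δ : ℝ → ℝ} {s : ℕ → ℝ} {v : ℕ → E} {N : ℕ}
    (hN : 0 < N) (h : ∀ i < N, IsFineSum H g δ (s i) (s (i + 1)) (v i)) :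
    IsFineSum H g δ (s 0) (s N) (∑ i ∈ Finset.range N, v i) := by
  induction N with
  | zero => omega
  | succ N ih =>
    rcases Nat.eq_zero_or_pos N with rfl | hN'
    · simpa using h 0 one_pos
    · rw [Finset.sum_range_succ]
      exact (ih hN' fun i hi => h i (by omega)).append (h N (by omega))

/-- The Saks–Henstock lemma. -/
lemma saks_henstock {H : ℝ → E} {g δ : ℝ → ℝ} {Ψ : ℝ → E} {A B ε : ℝ}
    (hδ : ∀ t, 0 < δ t)
    (hΨ : ∀ c d, A ≤ c → c ≤ d → d ≤ B → HasKSIntegral H g c d (Ψ d - Ψ c))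
    (hε : ∀ v, IsFineSum H g δ A B v → ‖v - (Ψ B - Ψ A)‖ < ε)
    {s : ℕ → ℝ} {N : ℕ} (hN : 0 < N) (hs : Monotone s) (hs0 : s 0 = A) (hsN : s N = B)
    (T : Finset ℕ) (hT : T ⊆ Finset.range N) (τ : ℕ → ℝ)
    (hτ : ∀ i ∈ T, τ i ∈ Icc (s i) (s (i + 1)))
    (hfine : ∀ i ∈ T, Icc (s i) (s (i + 1)) ⊆ Ioo (τ i - δ (τ i)) (τ i + δ (τ i))) :
    ‖∑ i ∈ T, ((g (s (i + 1)) - g (s i)) • H (τ i) - (Ψ (s (i + 1)) - Ψ (s i)))‖ ≤ ε := by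
  classical
  refine le_of_forall_pos_le_add fun η hη => ?_
  have hNpos : (0 : ℝ) < N := by exact_mod_cast hN
  have ex : ∀ i < N, ∃ v, IsFineSum H g δ (s i) (s (i + 1)) v ∧
      ‖v - (Ψ (s (i + 1)) - Ψ (s i))‖ ≤ η / N := by
    intro i hi
    have hle : s i ≤ s (i + 1) := hs (Nat.le_succ i)
    obtain ⟨δ', h1, h2⟩ := hasKSIntegral_iff.1
      (hΨ (s i) (s (i + 1)) (hs0 ▸ hs (Nat.zero_le _)) hle (hsN ▸ hs (by omega))) (η / N)
      (by positivity)
    obtain ⟨v, hv⟩ := exists_isFineSum H g (δ := fun t => min (δ t) (δ' t))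
      (fun t => lt_min (hδ t) (h1 t)) hle
    exact ⟨v, hv.mono fun t => min_le_left _ _,
      (h2 v (hv.mono fun t => min_le_right _ _)).le⟩
  choose! v hv hv' using ex
  let w : ℕ → E := fun i => if i ∈ T then (g (s (i + 1)) - g (s i)) • H (τ i) else v i
  have hw : IsFineSum H g δ A B (∑ i ∈ Finset.range N, w i) := by
    rw [← hs0, ← hsN]
    refine IsFineSum.sum_range hN fun i hi => ?_
    by_cases hiT : i ∈ T
    · simp only [w, if_pos hiT]
      exact IsFineSum.single (hτ i hiT) (hfine i hiT)
    · simp only [w, if_neg hiT]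
      exact hv i hi
  have h1 := hε _ hw
  rw [← hs0, ← hsN, ← Finset.sum_range_sub (fun i => Ψ (s i)), ← Finset.sum_sub_distrib,
    ← Finset.sum_sdiff hT] at h1
  have h2 : ∑ i ∈ T, (w i - (Ψ (s (i + 1)) - Ψ (s i))) =
      ∑ i ∈ T, ((g (s (i + 1)) - g (s i)) • H (τ i) - (Ψ (s (i + 1)) - Ψ (s i))) :=
    Finset.sum_congr rfl fun i hi => by simp [w, hi]
  rw [h2] at h1
  have h3 : ‖∑ i ∈ Finset.range N \ T, (w i - (Ψ (s (i + 1)) - Ψ (s i)))‖ ≤ η := by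
    calc _ ≤ ∑ i ∈ Finset.range N \ T, η / N := by
          refine norm_sum_le_of_le _ fun i hi => ?_
          rw [Finset.mem_sdiff, Finset.mem_range] at hi
          simpa [w, hi.2] using hv' i hi.1
      _ ≤ ∑ i ∈ Finset.range N, η / N :=
          Finset.sum_le_sum_of_subset_of_nonneg Finset.sdiff_subset fun _ _ _ => by positivity
      _ = η := by
          rw [Finset.sum_const, Finset.card_range, nsmul_eq_mul]
          field_simp
  set X := ∑ i ∈ Finset.range N \ T, (w i - (Ψ (s (i + 1)) - Ψ (s i)))
  set Y := ∑ i ∈ T, ((g (s (i + 1)) - g (s i)) • H (τ i) - (Ψ (s (i + 1)) - Ψ (s i)))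
  have : Y = (X + Y) - X := by abel
  rw [this]
  linarith [norm_sub_le (X + Y) X]

/-- The indefinite integral of an integrable function. -/
lemma KSIntegrable.exists_indefinite [CompleteSpace E] {H : ℝ → E} {g : ℝ → ℝ} {A B : ℝ}
    (h : KSIntegrable H g A B) :
    ∃ Ψ : ℝ → E, ∀ c d, A ≤ c → c ≤ d → d ≤ B → HasKSIntegral H g c d (Ψ d - Ψ c) := by
  have : ∀ t, A ≤ t → t ≤ B → ∃ I, HasKSIntegral H g A t I := fun t h1 h2 =>
    h.mono le_rfl h1 h2
  choose! Ψ hΨ using this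
  refine ⟨Ψ, fun c d h1 h2 h3 => ?_⟩
  obtain ⟨J, hJ⟩ := h.mono h1 h2 h3
  have := HasKSIntegral.append h1 h2 (hΨ c h1 (h2.trans h3)) hJ (hΨ d (h1.trans h2) h3)
  rwa [this, add_sub_cancel_left]

lemma TaggedPartition.s_mem_Icc {c d : ℝ} (P : TaggedPartition c d) {i : ℕ}
    (hi : i ≤ P.n) : P.s i ∈ Icc c d := by
  constructor
  · refine P.s_first.ge.trans ?_
    induction i with
    | zero => exact le_rfl
    | succ i ih => exact (ih (by omega)).trans (P.s_mono i (by omega))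
  · refine le_trans ?_ P.s_last.le
    induction hi using Nat.decreasingInduction with
    | self => exact le_rfl
    | of_succ k hk ih => exact (P.s_mono k hk).trans ih

lemma HasKSIntegral.congr_right {H : ℝ → E} {g g' : ℝ → ℝ} {c d : ℝ} {I : E}
    (h : HasKSIntegral H g c d I) (hg : ∀ t ∈ Icc c d, g t = g' t) :
    HasKSIntegral H g' c d I := by
  intro ε hε
  obtain ⟨δ, h1, h2⟩ := h ε hε
  refine ⟨δ, h1, fun P hP => ?_⟩
  have : P.sum H g' = P.sum H g := by
    refine Finset.sum_congr rfl fun i hi => ?_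
    have hi := Finset.mem_range.1 hi
    rw [hg _ (P.s_mem_Icc hi.le), hg _ (P.s_mem_Icc (i := i + 1) hi)]
  rw [this]
  exact h2 P hP

end FineSums

section Lebesgue

open MeasureTheory

lemma TaggedPartition.sum_le_integral {c d : ℝ} {μ : Measure ℝ} {F g w : ℝ → ℝ}
    (P : TaggedPartition c d) (hw : IntegrableOn w (Ico c d) μ)
    (h : ∀ i < P.n, (g (P.s (i + 1)) - g (P.s i)) * F (P.τ i) ≤
      ∫ x in Ico (P.s i) (P.s (i + 1)), w x ∂μ) :
    P.sum F g ≤ ∫ x in Ico c d, w x ∂μ := by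
  have key : ∀ m ≤ P.n, ∑ i ∈ Finset.range m, (g (P.s (i + 1)) - g (P.s i)) • F (P.τ i) ≤
      ∫ x in Ico c (P.s m), w x ∂μ := by
    intro m
    induction m with
    | zero => simp [P.s_first]
    | succ m ih =>
      intro hm
      have h1 := P.s_mem_Icc (i := m) (by omega)
      have h2 := P.s_mem_Icc hm
      have h3 := P.s_mono m (by omega)
      rw [Finset.sum_range_succ, ← Ico_union_Ico_eq_Ico h1.1 h3, setIntegral_union
        ((Ico_disjoint_Ico_same)) measurableSet_Ico
        (hw.mono_set (Ico_subset_Ico_right h1.2)) (hw.mono_set (Ico_subset_Ico h1.1 h2.2))]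
      exact add_le_add (ih (by omega)) (by simpa using h m (by omega))
  have := key P.n le_rfl
  rwa [P.s_last] at this

lemma exists_gauge_sum_le {μ : Measure ℝ} [IsFiniteMeasure μ] {F g : ℝ → ℝ} {c d : ℝ}
    (hμ : ∀ a b, a ≤ b → μ (Ico a b) = ENNReal.ofReal (g b - g a)) (hg : Monotone g)
    (hcd : c ≤ d) (hF : IntegrableOn F (Ico c d) μ) {ε : ℝ} (hε : 0 < ε) :
    ∃ δ : ℝ → ℝ, (∀ t, 0 < δ t) ∧ ∀ P : TaggedPartition c d, P.IsFine δ →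
      P.sum F g < ∫ x in Ico c d, F x ∂μ + ε := by
  have hgcd : 0 ≤ g d - g c := sub_nonneg.2 (hg hcd)
  obtain ⟨u, hu1, hu2, hu3, hu4, hu5⟩ :=
    exists_lt_lowerSemicontinuous_integral_lt (μ := μ.restrict (Ico c d)) F hF (half_pos hε)
  have ex : ∀ t, ∃ δ > (0 : ℝ), ∀ y ∈ Ioo (t - δ) (t + δ), (F t : EReal) < u y := by
    intro t
    obtain ⟨δ, h1, h2⟩ := Metric.eventually_nhds_iff.1 (hu2 t (F t) (hu1 t))
    refine ⟨δ, h1, fun y hy => h2 ?_⟩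
    rw [Real.dist_eq, abs_lt]
    constructor <;> linarith [hy.1, hy.2]
  choose δ hδ hδ' using ex
  refine ⟨δ, hδ, fun P hP => ?_⟩
  have h1 : P.sum F g ≤ ∫ x in Ico c d, (u x).toReal ∂μ := by
    refine P.sum_le_integral hu3 fun i hi => ?_
    have m1 := P.s_mem_Icc hi.le
    have m2 := P.s_mem_Icc (i := i + 1) hi
    have m3 := P.s_mono i hi
    have hsub : Ico (P.s i) (P.s (i + 1)) ⊆ Ico c d := Ico_subset_Ico m1.1 m2.2
    have : (g (P.s (i + 1)) - g (P.s i)) * F (P.τ i) =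
        ∫ _x in Ico (P.s i) (P.s (i + 1)), F (P.τ i) ∂μ := by
      rw [setIntegral_const, measureReal_def, hμ _ _ m3,
        ENNReal.toReal_ofReal (sub_nonneg.2 (hg m3)), smul_eq_mul]
    rw [this]
    refine setIntegral_mono_on_ae (integrableOn_const (by finiteness) ) (hu3.mono_measure
      (Measure.restrict_mono hsub le_rfl)) measurableSet_Ico ?_
    have hu4' := (ae_restrict_iff' measurableSet_Ico).1 hu4
    filter_upwards [hu4'] with x hx hxI
    have hlt := hδ' _ _ (hP i hi ⟨hxI.1, hxI.2.le⟩)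
    have hne : u x ≠ ⊤ := (hx (hsub hxI)).ne
    have hnb : u x ≠ ⊥ := (bot_lt_of_lt hlt).ne'
    rw [← EReal.coe_toReal hne hnb, EReal.coe_lt_coe_iff] at hlt
    exact hlt.le
  linarith

/-- A Lebesgue–Stieltjes integrable function is Kurzweil–Stieltjes integrable, with the same
integral. -/
lemma hasKSIntegral_of_integrableOn {μ : Measure ℝ} [IsFiniteMeasure μ] {F g : ℝ → ℝ} {c d : ℝ}
    (hμ : ∀ a b, a ≤ b → μ (Ico a b) = ENNReal.ofReal (g b - g a)) (hg : Monotone g)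
    (hcd : c ≤ d) (hF : IntegrableOn F (Ico c d) μ) :
    HasKSIntegral F g c d (∫ x in Ico c d, F x ∂μ) := by
  intro ε hε
  obtain ⟨δ, h1, h2⟩ := exists_gauge_sum_le hμ hg hcd hF hε
  obtain ⟨δ', h1', h2'⟩ := exists_gauge_sum_le hμ hg hcd hF.neg hε
  refine ⟨fun t => min (δ t) (δ' t), fun t => lt_min (h1 t) (h1' t), fun P hP => ?_⟩
  have e1 := h2 P fun i hi => (hP i hi).trans
    (Ioo_subset_Ioo (by linarith [min_le_left (δ (P.τ i)) (δ' (P.τ i))])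
      (by linarith [min_le_left (δ (P.τ i)) (δ' (P.τ i))]))
  have e2 := h2' P fun i hi => (hP i hi).trans
    (Ioo_subset_Ioo (by linarith [min_le_right (δ (P.τ i)) (δ' (P.τ i))])
      (by linarith [min_le_right (δ (P.τ i)) (δ' (P.τ i))]))
  have e3 : P.sum (-F) g = - P.sum F g := by
    simp [TaggedPartition.sum]
  rw [e3] at e2
  simp only [Pi.neg_apply, integral_neg] at e2
  rw [Real.norm_eq_abs, abs_lt]
  constructor <;> linarith

end Lebesgue

section Measurability

open MeasureTheory

lemma exists_monotone_division {A B r : ℝ} (hAB : A < B) (hr : 0 < r) :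
    ∃ (s : ℕ → ℝ) (N : ℕ), 0 < N ∧ Monotone s ∧ s 0 = A ∧ s N = B ∧
      ∀ i, s (i + 1) - s i < r := by
  obtain ⟨N, hN⟩ := exists_nat_gt ((B - A) / r)
  have hpos : (0 : ℝ) < N := lt_trans (div_pos (sub_pos.2 hAB) hr) hN
  refine ⟨fun i => A + i * ((B - A) / N), N, by exact_mod_cast hpos, ?_, by simp, ?_, ?_⟩
  · intro i j hij
    have : (i : ℝ) ≤ j := by exact_mod_cast hij
    have h2 : 0 ≤ (B - A) / N := div_nonneg (sub_pos.2 hAB).le hpos.le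
    simp only
    gcongr
  · simp only
    field_simp
    ring
  · intro i
    have : (B - A) / N < r := by
      rw [div_lt_iff₀ hr] at hN
      rw [div_lt_iff₀ hpos]
      linarith
    push_cast
    linarith

lemma Icc_subset_Ioo_of_sub_lt {a b τ δ : ℝ} (hτ : τ ∈ Icc a b) (h : b - a < δ) :
    Icc a b ⊆ Ioo (τ - δ) (τ + δ) := fun y hy =>
  ⟨by linarith [hτ.2, hy.1], by linarith [hτ.1, hy.2]⟩

lemma measureReal_Ico_eq {μ : Measure ℝ} {g : ℝ → ℝ} (hg : Monotone g)
    (hμ : ∀ a b, a ≤ b → μ (Ico a b) = ENNReal.ofReal (g b - g a)) {a b : ℝ} (hab : a ≤ b) :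
    μ.real (Ico a b) = g b - g a := by
  rw [measureReal_def, hμ _ _ hab, ENNReal.toReal_ofReal (sub_nonneg.2 (hg hab))]

open Classical in
/-- The indices of the pieces of a division that meet `S`. -/
noncomputable def meetingIndices (s : ℕ → ℝ) (N : ℕ) (S : Set ℝ) : Finset ℕ :=
  (Finset.range N).filter fun i => (Ico (s i) (s (i + 1)) ∩ S).Nonempty

lemma mem_meetingIndices {s : ℕ → ℝ} {N : ℕ} {S : Set ℝ} {i : ℕ} :
    i ∈ meetingIndices s N S ↔ i < N ∧ (Ico (s i) (s (i + 1)) ∩ S).Nonempty := by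
  simp [meetingIndices]

lemma measureReal_le_sum_meetingIndices {μ : Measure ℝ} [IsFiniteMeasure μ] {g : ℝ → ℝ}
    (hg : Monotone g) (hμ : ∀ a b, a ≤ b → μ (Ico a b) = ENNReal.ofReal (g b - g a))
    {s : ℕ → ℝ} (hs : Monotone s) {N : ℕ} {S : Set ℝ} (hS : S ⊆ Ico (s 0) (s N)) :
    μ.real S ≤ ∑ i ∈ meetingIndices s N S, (g (s (i + 1)) - g (s i)) := by
  have hsub : S ⊆ ⋃ i ∈ meetingIndices s N S, Ico (s i) (s (i + 1)) := by
    intro x hx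
    have := Ico_subset_biUnion_Ico N s (hS hx)
    simp only [mem_iUnion, Finset.mem_range, exists_prop] at this ⊢
    obtain ⟨i, hi, hxi⟩ := this
    exact ⟨i, mem_meetingIndices.2 ⟨by simpa using hi, x, hxi, hx⟩, hxi⟩
  refine (measureReal_mono hsub (measure_ne_top _ _)).trans ?_
  refine (measureReal_biUnion_finset_le _ _).trans (Finset.sum_le_sum fun i _ => ?_)
  exact (measureReal_Ico_eq hg hμ (hs (Nat.le_succ i))).le

lemma tendsto_measureReal_iUnion {μ : Measure ℝ} [IsFiniteMeasure μ] {S : ℕ → Set ℝ}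
    (hS : Monotone S) : Tendsto (fun n => μ.real (S n)) atTop (𝓝 (μ.real (⋃ n, S n))) :=
  (ENNReal.tendsto_toReal (by finiteness)).comp (tendsto_measure_iUnion_atTop hS)

/-- Points of `S` where a positive function exceeds `1 / (n + 1)` exhaust `S`. -/
lemma tendsto_measureReal_gauge {μ : Measure ℝ} [IsFiniteMeasure μ] {δ : ℝ → ℝ}
    (hδ : ∀ t, 0 < δ t) (S : Set ℝ) :
    Tendsto (fun n : ℕ => μ.real {t ∈ S | 1 / ((n : ℝ) + 1) < δ t}) atTop (𝓝 (μ.real S)) := by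
  have hU : (⋃ n : ℕ, {t ∈ S | 1 / ((n : ℝ) + 1) < δ t}) = S := by
    ext t
    simp only [mem_iUnion, mem_ofPred_eq]
    refine ⟨fun ⟨n, h, _⟩ => h, fun h => ?_⟩
    obtain ⟨n, hn⟩ := exists_nat_one_div_lt (hδ t)
    exact ⟨n, h, hn⟩
  have := tendsto_measureReal_iUnion (μ := μ) (S := fun n : ℕ => {t ∈ S | 1 / ((n : ℝ) + 1) < δ t})
    (by
      intro n m hnm t ht
      exact ⟨ht.1, lt_of_le_of_lt (Nat.one_div_le_one_div hnm) ht.2⟩)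
  rwa [hU] at this

lemma measureReal_le_add_measureReal_ge_le {μ : Measure ℝ} [IsFiniteMeasure μ] {H g Ψ : ℝ → ℝ}
    {A B : ℝ} (hAB : A < B) (hg : Monotone g)
    (hμ : ∀ a b, a ≤ b → μ (Ico a b) = ENNReal.ofReal (g b - g a))
    (hΨ : ∀ c d, A ≤ c → c ≤ d → d ≤ B → HasKSIntegral H g c d (Ψ d - Ψ c))
    {p q : ℝ} (hpq : p < q) :
    μ.real {t ∈ Ico A B | H t ≤ p} + μ.real {t ∈ Ico A B | q ≤ H t} ≤ μ.real (Ico A B) := by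
  classical
  refine le_of_forall_pos_le_add fun η hη => ?_
  set ε := η * (q - p) / 2 with hε
  have hε0 : 0 < ε := by have := sub_pos.2 hpq; positivity
  obtain ⟨δ, hδ, hδ'⟩ := hasKSIntegral_iff.1 (hΨ A B le_rfl hAB.le le_rfl) ε hε0
  refine le_of_tendsto ((tendsto_measureReal_gauge hδ _).add (tendsto_measureReal_gauge hδ _))
    (Eventually.of_forall fun n => ?_)
  obtain ⟨s, N, hN, hs, hs0, hsN, hsr⟩ := exists_monotone_division hAB
    (show (0 : ℝ) < 1 / ((n : ℝ) + 1) from Nat.one_div_pos_of_nat)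
  set X := {t ∈ {t ∈ Ico A B | H t ≤ p} | 1 / ((n : ℝ) + 1) < δ t}
  set Y := {t ∈ {t ∈ Ico A B | q ≤ H t} | 1 / ((n : ℝ) + 1) < δ t}
  have hX := measureReal_le_sum_meetingIndices hg hμ hs (N := N) (S := X)
    (by rw [hs0, hsN]; exact fun t ht => ht.1.1)
  have hY := measureReal_le_sum_meetingIndices hg hμ hs (N := N) (S := Y)
    (by rw [hs0, hsN]; exact fun t ht => ht.1.1)
  set T := meetingIndices s N X with hT
  set T' := meetingIndices s N Y with hT'
  have hΔ : ∀ i, 0 ≤ g (s (i + 1)) - g (s i) := fun i => sub_nonneg.2 (hg (hs (Nat.le_succ i)))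
  have hunion : ∑ i ∈ T ∪ T', (g (s (i + 1)) - g (s i)) ≤ μ.real (Ico A B) := by
    rw [measureReal_Ico_eq hg hμ hAB.le, ← hs0, ← hsN,
      ← Finset.sum_range_sub (fun i => g (s i))]
    refine Finset.sum_le_sum_of_subset_of_nonneg (fun i hi => ?_) fun i _ _ => hΔ i
    rcases Finset.mem_union.1 hi with h | h
    · exact Finset.mem_range.2 (mem_meetingIndices.1 h).1
    · exact Finset.mem_range.2 (mem_meetingIndices.1 h).1
  have hx : ∀ i ∈ T ∩ T', ∃ x, x ∈ Ico (s i) (s (i + 1)) ∩ X := fun i hi =>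
    (mem_meetingIndices.1 (Finset.mem_inter.1 hi).1).2
  have hy : ∀ i ∈ T ∩ T', ∃ x, x ∈ Ico (s i) (s (i + 1)) ∩ Y := fun i hi =>
    (mem_meetingIndices.1 (Finset.mem_inter.1 hi).2).2
  choose! x hx using hx
  choose! y hy using hy
  have hsub : T ∩ T' ⊆ Finset.range N := fun i hi =>
    Finset.mem_range.2 (mem_meetingIndices.1 (Finset.mem_inter.1 hi).1).1
  have h1 := saks_henstock hδ hΨ hδ' hN hs hs0 hsN (T ∩ T') hsub x
    (fun i hi => Ico_subset_Icc_self (hx i hi).1)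
    (fun i hi => Icc_subset_Ioo_of_sub_lt (Ico_subset_Icc_self (hx i hi).1)
      ((hsr i).trans (hx i hi).2.2))
  have h2 := saks_henstock hδ hΨ hδ' hN hs hs0 hsN (T ∩ T') hsub y
    (fun i hi => Ico_subset_Icc_self (hy i hi).1)
    (fun i hi => Icc_subset_Ioo_of_sub_lt (Ico_subset_Icc_self (hy i hi).1)
      ((hsr i).trans (hy i hi).2.2))
  rw [Real.norm_eq_abs, abs_le, Finset.sum_sub_distrib] at h1 h2
  have h3 : (q - p) * ∑ i ∈ T ∩ T', (g (s (i + 1)) - g (s i)) ≤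
      ∑ i ∈ T ∩ T', (g (s (i + 1)) - g (s i)) • H (y i) -
      ∑ i ∈ T ∩ T', (g (s (i + 1)) - g (s i)) • H (x i) := by
    rw [Finset.mul_sum, ← Finset.sum_sub_distrib]
    refine Finset.sum_le_sum fun i hi => ?_
    have e1 : H (x i) ≤ p := (hx i hi).2.1.2
    have e2 : q ≤ H (y i) := (hy i hi).2.1.2
    rw [smul_eq_mul, smul_eq_mul, ← mul_sub, mul_comm]
    exact mul_le_mul_of_nonneg_left (by linarith) (hΔ i)
  have h4 : ∑ i ∈ T ∩ T', (g (s (i + 1)) - g (s i)) ≤ η := by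
    have : (q - p) * ∑ i ∈ T ∩ T', (g (s (i + 1)) - g (s i)) ≤ (q - p) * η := by
      linarith [h1.1, h2.2]
    exact le_of_mul_le_mul_left this (sub_pos.2 hpq)
  have h5 := Finset.sum_union_inter (s₁ := T) (s₂ := T')
    (f := fun i => g (s (i + 1)) - g (s i))
  linarith

lemma nullMeasurableSet_of_measureReal_add_le {κ : Measure ℝ} [IsFiniteMeasure κ] {S : Set ℝ}
    (h : κ.real S + κ.real Sᶜ ≤ κ.real univ) : NullMeasurableSet S κ := by
  set X := toMeasurable κ S
  set Y := toMeasurable κ Sᶜ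
  have hX : MeasurableSet X := measurableSet_toMeasurable κ S
  have hY : MeasurableSet Y := measurableSet_toMeasurable κ Sᶜ
  have hU : X ∪ Y = univ := by
    refine eq_univ_of_univ_subset ?_
    rw [← union_compl_self S]
    exact union_subset_union (subset_toMeasurable κ S) (subset_toMeasurable κ Sᶜ)
  have h1 := measureReal_union_add_inter (μ := κ) (s := X) hY
  rw [hU, measureReal_def κ X, measureReal_def κ Y, measure_toMeasurable, measure_toMeasurable,
    ← measureReal_def, ← measureReal_def] at h1
  have h2 : κ.real (X ∩ Y) = 0 := le_antisymm (by linarith) measureReal_nonneg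
  have h3 : κ (X ∩ Y) = 0 := (measureReal_eq_zero_iff).1 h2
  have h4 : S =ᵐ[κ] X := by
    refine EventuallyLE.antisymm (ae_le_set.2 ?_) (ae_le_set.2 ?_)
    · rw [sdiff_eq_empty.2 (subset_toMeasurable κ S), measure_empty]
    · exact measure_mono_null (show X \ S ⊆ X ∩ Y from
        fun x hx => ⟨hx.1, subset_toMeasurable κ Sᶜ hx.2⟩) h3
  exact ⟨X, hX, h4⟩

/-- A Kurzweil–Stieltjes integrable function is measurable for the Stieltjes measure. -/
lemma aemeasurable_of_hasKSIntegral {μ : Measure ℝ} [IsFiniteMeasure μ] {H g Ψ : ℝ → ℝ}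
    {A B : ℝ} (hAB : A < B) (hg : Monotone g)
    (hμ : ∀ a b, a ≤ b → μ (Ico a b) = ENNReal.ofReal (g b - g a))
    (hΨ : ∀ c d, A ≤ c → c ≤ d → d ≤ B → HasKSIntegral H g c d (Ψ d - Ψ c)) :
    AEMeasurable H (μ.restrict (Ico A B)) := by
  refine NullMeasurable.aemeasurable ?_
  have key : ∀ p, NullMeasurableSet (H ⁻¹' Iic p) (μ.restrict (Ico A B)) := by
    intro p
    refine nullMeasurableSet_of_measureReal_add_le ?_
    rw [measureReal_restrict_apply' measurableSet_Ico,
      measureReal_restrict_apply' measurableSet_Ico,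
      measureReal_restrict_apply' measurableSet_Ico, univ_inter]
    have hmono : Monotone fun n : ℕ => {t ∈ Ico A B | p + 1 / ((n : ℝ) + 1) ≤ H t} := by
      intro n m hnm t ht
      have := Nat.one_div_le_one_div (α := ℝ) hnm
      exact ⟨ht.1, by linarith [ht.2]⟩
    have hU : (⋃ n : ℕ, {t ∈ Ico A B | p + 1 / ((n : ℝ) + 1) ≤ H t}) =
        (H ⁻¹' Iic p)ᶜ ∩ Ico A B := by
      ext t
      simp only [mem_iUnion, mem_ofPred_eq, mem_inter_iff, mem_compl_iff, mem_preimage, mem_Iic,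
        not_le]
      constructor
      · rintro ⟨n, h1, h2⟩
        have : (0 : ℝ) < 1 / ((n : ℝ) + 1) := Nat.one_div_pos_of_nat
        exact ⟨by linarith, h1⟩
      · rintro ⟨h1, h2⟩
        obtain ⟨n, hn⟩ := exists_nat_one_div_lt (sub_pos.2 h1)
        exact ⟨n, h2, by linarith⟩
    have hlim := tendsto_measureReal_iUnion (μ := μ) hmono
    rw [hU] at hlim
    have hE : H ⁻¹' Iic p ∩ Ico A B = {t ∈ Ico A B | H t ≤ p} := by
      ext t
      simp [and_comm]
    rw [hE]
    refine le_of_tendsto (hlim.const_add _) (Eventually.of_forall fun n => ?_)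
    exact measureReal_le_add_measureReal_ge_le hAB hg hμ hΨ
      (by linarith [show (0 : ℝ) < 1 / ((n : ℝ) + 1) from Nat.one_div_pos_of_nat])
  exact measurable_of_Iic key

/-- If the indefinite integral of `H` grows at most as fast as `ν`, then the Stieltjes measure
of a set where `q ≤ H` is controlled by `ν`. -/
lemma mul_measureReal_le_of_isOpen {μ ν : Measure ℝ} [IsFiniteMeasure μ] [IsFiniteMeasure ν]
    {H g Ψ : ℝ → ℝ} {A B : ℝ} (hAB : A < B) (hg : Monotone g)
    (hμ : ∀ a b, a ≤ b → μ (Ico a b) = ENNReal.ofReal (g b - g a))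
    (hΨ : ∀ c d, A ≤ c → c ≤ d → d ≤ B → HasKSIntegral H g c d (Ψ d - Ψ c))
    (hν : ∀ c d, A ≤ c → c ≤ d → d ≤ B → Ψ d - Ψ c ≤ ν.real (Icc c d))
    {q : ℝ} (hq : 0 ≤ q) {S U : Set ℝ} (hS : S ⊆ Ico A B) (hSq : ∀ t ∈ S, q ≤ H t)
    (hSU : S ⊆ U) (hU : IsOpen U) : q * μ.real S ≤ 2 * ν.real U := by
  refine le_of_forall_pos_le_add fun ε hε => ?_
  obtain ⟨δ₀, hδ₀, hδ₀'⟩ := hasKSIntegral_iff.1 (hΨ A B le_rfl hAB.le le_rfl) ε hε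
  have ex : ∀ t, ∃ δ > (0 : ℝ), δ ≤ δ₀ t ∧ (t ∈ U → Ioo (t - δ) (t + δ) ⊆ U) := by
    intro t
    by_cases ht : t ∈ U
    · obtain ⟨r, hr, hrU⟩ := Metric.isOpen_iff.1 hU t ht
      rw [Real.ball_eq_Ioo] at hrU
      refine ⟨min (δ₀ t) r, lt_min (hδ₀ t) hr, min_le_left _ _, fun _ =>
        (Ioo_subset_Ioo ?_ ?_).trans hrU⟩ <;> linarith [min_le_right (δ₀ t) r]
    · exact ⟨δ₀ t, hδ₀ t, le_rfl, fun h => absurd h ht⟩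
  choose δ hδ hδle hδU using ex
  have hδ' : ∀ v, IsFineSum H g δ A B v → ‖v - (Ψ B - Ψ A)‖ < ε := fun v hv =>
    hδ₀' v (hv.mono hδle)
  refine le_of_tendsto ((tendsto_measureReal_gauge hδ S).const_mul q)
    (Eventually.of_forall fun n => ?_)
  obtain ⟨s, N, hN, hs, hs0, hsN, hsr⟩ := exists_monotone_division hAB
    (show (0 : ℝ) < 1 / ((n : ℝ) + 1) from Nat.one_div_pos_of_nat)
  set X := {t ∈ S | 1 / ((n : ℝ) + 1) < δ t}
  have hX := measureReal_le_sum_meetingIndices hg hμ hs (N := N) (S := X)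
    (by rw [hs0, hsN]; exact fun t ht => hS ht.1)
  set T := meetingIndices s N X with hT
  have hx : ∀ i ∈ T, ∃ x, x ∈ Ico (s i) (s (i + 1)) ∩ X := fun i hi =>
    (mem_meetingIndices.1 hi).2
  choose! x hx using hx
  have hlt : ∀ i ∈ T, i < N := fun i hi => (mem_meetingIndices.1 hi).1
  have hfine : ∀ i ∈ T, Icc (s i) (s (i + 1)) ⊆ Ioo (x i - δ (x i)) (x i + δ (x i)) :=
    fun i hi => Icc_subset_Ioo_of_sub_lt (Ico_subset_Icc_self (hx i hi).1)
      ((hsr i).trans (hx i hi).2.2)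
  have h1 := saks_henstock hδ hΨ hδ' hN hs hs0 hsN T
    (fun i hi => Finset.mem_range.2 (hlt i hi)) x
    (fun i hi => Ico_subset_Icc_self (hx i hi).1) hfine
  rw [Real.norm_eq_abs, abs_le, Finset.sum_sub_distrib] at h1
  have hsubU : ∀ i ∈ T, Icc (s i) (s (i + 1)) ⊆ U := fun i hi =>
    (hfine i hi).trans (hδU _ (hSU (hx i hi).2.1))
  have h2 : q * ∑ i ∈ T, (g (s (i + 1)) - g (s i)) ≤
      ∑ i ∈ T, (g (s (i + 1)) - g (s i)) • H (x i) := by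
    rw [Finset.mul_sum]
    refine Finset.sum_le_sum fun i hi => ?_
    rw [smul_eq_mul, mul_comm]
    exact mul_le_mul_of_nonneg_left (hSq _ (hx i hi).2.1)
      (sub_nonneg.2 (hg (hs (Nat.le_succ i))))
  have h3 : ∑ i ∈ T, (Ψ (s (i + 1)) - Ψ (s i)) ≤
      ∑ i ∈ T, ν.real (Ico (s i) (s (i + 1))) + ∑ i ∈ T, ν.real (Ioc (s i) (s (i + 1))) := by
    rw [← Finset.sum_add_distrib]
    refine Finset.sum_le_sum fun i hi => ?_
    refine (hν _ _ (hs0 ▸ hs (Nat.zero_le i)) (hs (Nat.le_succ i))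
      (hsN ▸ hs (hlt i hi))).trans ?_
    refine le_trans (measureReal_mono ?_) (measureReal_union_le _ _)
    intro t ht
    rcases ht.2.eq_or_lt with h | h
    · have := (hx i hi).1
      exact Or.inr ⟨by rw [h]; exact this.1.trans_lt this.2, ht.2⟩
    · exact Or.inl ⟨ht.1, h⟩
  have h4 : ∑ i ∈ T, ν.real (Ico (s i) (s (i + 1))) ≤ ν.real U := by
    have h := measureReal_biUnion_finset (μ := ν) (s := T) (f := fun i => Ico (s i) (s (i + 1)))
      (fun i _ j _ hij => hs.pairwise_disjoint_on_Ico_succ hij) (fun _ _ => measurableSet_Ico)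
    rw [← h]
    exact measureReal_mono (iUnion₂_subset fun i hi => Ico_subset_Icc_self.trans (hsubU i hi))
  have h5 : ∑ i ∈ T, ν.real (Ioc (s i) (s (i + 1))) ≤ ν.real U := by
    have h := measureReal_biUnion_finset (μ := ν) (s := T) (f := fun i => Ioc (s i) (s (i + 1)))
      (fun i _ j _ hij => hs.pairwise_disjoint_on_Ioc_succ hij) (fun _ _ => measurableSet_Ioc)
    rw [← h]
    exact measureReal_mono (iUnion₂_subset fun i hi => Ioc_subset_Icc_self.trans (hsubU i hi))
  have h6 := mul_le_mul_of_nonneg_left hX hq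
  linarith [h1.2]

lemma ae_le_rnDeriv {μ ν : Measure ℝ} [IsFiniteMeasure μ] [IsFiniteMeasure ν]
    {H g Ψ : ℝ → ℝ} {A B : ℝ} (hAB : A < B) (hg : Monotone g)
    (hμ : ∀ a b, a ≤ b → μ (Ico a b) = ENNReal.ofReal (g b - g a))
    (hΨ : ∀ c d, A ≤ c → c ≤ d → d ≤ B → HasKSIntegral H g c d (Ψ d - Ψ c))
    (hν : ∀ c d, A ≤ c → c ≤ d → d ≤ B → Ψ d - Ψ c ≤ ν.real (Icc c d)) :
    ∀ᵐ t ∂μ, t ∈ Ico A B → H t ≤ 2 * (ν.rnDeriv μ t).toReal := by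
  obtain ⟨Z, hZ, hZν, hZμ⟩ := Measure.mutuallySingular_singularPart ν μ
  have key : ∀ q : ℚ, 0 < (q : ℝ) →
      μ {t ∈ Ico A B | (q : ℝ) ≤ H t ∧ 2 * (ν.rnDeriv μ t).toReal < q ∧ t ∈ Z} = 0 := by
    intro q hq
    set S := {t ∈ Ico A B | (q : ℝ) ≤ H t ∧ 2 * (ν.rnDeriv μ t).toReal < q ∧ t ∈ Z}
    set S' := toMeasurable μ S ∩ ({t | 2 * (ν.rnDeriv μ t).toReal < q} ∩ Z)
    have hS'm : MeasurableSet S' := (measurableSet_toMeasurable _ _).inter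
      ((measurableSet_lt (by fun_prop) measurable_const).inter hZ)
    have hSS' : S ⊆ S' := fun t ht => ⟨subset_toMeasurable _ _ ht, ht.2.2.1, ht.2.2.2⟩
    have hμS : μ.real S = μ.real S' := le_antisymm (measureReal_mono hSS') (by
      refine (measureReal_mono (inter_subset_left)).trans_eq ?_
      rw [measureReal_def, measure_toMeasurable, measureReal_def])
    have h1 : q * μ.real S ≤ 2 * ν.real S' := by
      refine le_of_forall_pos_le_add fun ε hε => ?_
      obtain ⟨U, hSU, hUo, hU⟩ := Set.exists_isOpen_lt_of_lt S' (ν S' + ENNReal.ofReal (ε / 2))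
        (ENNReal.lt_add_right (by finiteness) (by simpa using half_pos hε))
      have h2 := mul_measureReal_le_of_isOpen hAB hg hμ hΨ hν hq.le (S := S) (fun t ht => ht.1)
        (fun t ht => ht.2.1) (hSS'.trans hSU) hUo
      have h3 : ν.real U ≤ ν.real S' + ε / 2 := by
        have := ENNReal.toReal_mono (by finiteness) hU.le
        rwa [ENNReal.toReal_add (by finiteness) (by finiteness),
          ENNReal.toReal_ofReal (half_pos hε).le] at this
      linarith
    have h2 : ν.real S' = ∫ t in S', (ν.rnDeriv μ t).toReal ∂μ := by
      have hdec := congrArg (fun m : Measure ℝ => m S')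
        (Measure.haveLebesgueDecomposition_add ν μ)
      simp only [Measure.add_apply] at hdec
      rw [measure_mono_null (inter_subset_right.trans inter_subset_right) hZν, zero_add,
        withDensity_apply _ hS'm] at hdec
      rw [measureReal_def, hdec, integral_toReal (by fun_prop)
        (ae_restrict_of_ae (Measure.rnDeriv_lt_top ν μ))]
    have hint : IntegrableOn (fun t => (ν.rnDeriv μ t).toReal) S' μ :=
      Measure.integrable_toReal_rnDeriv.integrableOn
    have h3 : ∫ t in S', (q - 2 * (ν.rnDeriv μ t).toReal) ∂μ ≤ 0 := by
      rw [integral_sub (by simp) (hint.const_mul 2), integral_const_mul, ← h2,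
        setIntegral_const, smul_eq_mul]
      rw [hμS] at h1
      linarith
    have h4 : 0 ≤ᵐ[μ.restrict S'] fun t => (q - 2 * (ν.rnDeriv μ t).toReal) :=
      (ae_restrict_iff' hS'm).2 (Eventually.of_forall fun t ht => sub_nonneg.2 ht.2.1.le)
    have h5 := (setIntegral_eq_zero_iff_of_nonneg_ae h4
      ((integrable_const _).sub (hint.const_mul 2))).1
      (le_antisymm h3 (integral_nonneg_of_ae h4))
    rw [EventuallyEq, ae_restrict_iff' hS'm] at h5
    refine measure_mono_null (fun t ht => ?_) h5
    simp only [mem_compl_iff, mem_ofPred_eq, Pi.zero_apply]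
    intro h6
    have := h6 (hSS' ht)
    have h7 : 2 * (ν.rnDeriv μ t).toReal < q := (hSS' ht).2.1
    linarith
  have hall : ∀ᵐ t ∂μ, ∀ q : ℚ, 0 < (q : ℝ) →
      ¬ (t ∈ Ico A B ∧ (q : ℝ) ≤ H t ∧ 2 * (ν.rnDeriv μ t).toReal < q ∧ t ∈ Z) := by
    rw [ae_all_iff]
    intro q
    by_cases hq : 0 < (q : ℝ)
    · have := key q hq
      rw [measure_eq_zero_iff_ae_notMem] at this
      filter_upwards [this] with t ht _
      exact ht
    · exact Eventually.of_forall fun t h => absurd h hq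
  have hZ' : ∀ᵐ t ∂μ, t ∈ Z := by
    rw [ae_iff]
    exact hZμ
  filter_upwards [hall, hZ'] with t h1 h2 h3
  by_contra! h4
  obtain ⟨q, hq1, hq2⟩ := exists_rat_btwn h4
  have : 0 ≤ 2 * (ν.rnDeriv μ t).toReal := by positivity
  exact h1 q (by linarith) ⟨h3, hq2.le, hq1, h2⟩

end Measurability

section Stieltjes

open MeasureTheory

lemma max_min_mem_Icc {A B : ℝ} (hAB : A ≤ B) (t : ℝ) : max A (min t B) ∈ Icc A B :=
  ⟨le_max_left _ _, max_le hAB (min_le_right _ _)⟩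

lemma monotone_clamp {g : ℝ → ℝ} {A B : ℝ} (hAB : A ≤ B) (hg : MonotoneOn g (Icc A B)) :
    Monotone fun t => g (max A (min t B)) := fun _ _ hst =>
  hg (max_min_mem_Icc hAB _) (max_min_mem_Icc hAB _) (max_le_max_left _ (min_le_min_right _ hst))

lemma clamp_eq {A B t : ℝ} (ht : t ∈ Icc A B) : max A (min t B) = t := by
  rw [min_eq_left ht.2, max_eq_right ht.1]

lemma isFiniteMeasure_stieltjes_clamp {g : ℝ → ℝ} {A B : ℝ} (hAB : A ≤ B)
    (hg : MonotoneOn g (Icc A B)) :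
    IsFiniteMeasure (monotone_clamp hAB hg).stieltjesFunction.measure := by
  have hm := monotone_clamp hAB hg
  refine StieltjesFunction.isFiniteMeasure_of_forall_abs_le _ (C := |g A| + |g B|) fun x => ?_
  have h1 : ∀ t, g A ≤ g (max A (min t B)) ∧ g (max A (min t B)) ≤ g B := fun t =>
    ⟨hg (left_mem_Icc.2 hAB) (max_min_mem_Icc hAB _) (le_max_left _ _),
      hg (max_min_mem_Icc hAB _) (right_mem_Icc.2 hAB) (max_min_mem_Icc hAB _).2⟩
  have h2 := (h1 x).1.trans (hm.le_rightLim le_rfl)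
  have h3 := (hm.rightLim_le (lt_add_one x)).trans (h1 (x + 1)).2
  rw [Monotone.stieltjesFunction_eq, abs_le]
  constructor
  · linarith [neg_abs_le (g A), abs_nonneg (g B)]
  · linarith [le_abs_self (g B), abs_nonneg (g A)]

/-- The Stieltjes measure of a left-continuous nondecreasing function on `[A, B]`. -/
lemma exists_measure_Ico {g : ℝ → ℝ} {A B : ℝ} (hAB : A < B) (hg : MonotoneOn g (Icc A B))
    (hlc : LeftContinuousOn g A B) :
    ∃ (g' : ℝ → ℝ) (μ : Measure ℝ), IsFiniteMeasure μ ∧ Monotone g' ∧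
      (∀ t ∈ Icc A B, g t = g' t) ∧
      ∀ a b, a ≤ b → μ (Ico a b) = ENNReal.ofReal (g' b - g' a) := by
  have hm := monotone_clamp hAB.le hg
  refine ⟨_, _, isFiniteMeasure_stieltjes_clamp hAB.le hg, hm, fun t ht => by
    simp only [clamp_eq ht], fun a b _ => ?_⟩
  have key : ∀ t, Function.leftLim (fun t => g (max A (min t B))) t = g (max A (min t B)) := by
    intro t
    refine leftLim_eq_of_tendsto ?_
    rcases le_or_gt t A with h | h
    · refine Tendsto.congr' ?_ tendsto_const_nhds
      filter_upwards [self_mem_nhdsWithin] with s hs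
      have hs : s < t := hs
      rw [max_eq_left (min_le_of_left_le h), max_eq_left (min_le_of_left_le (hs.le.trans h))]
    rcases le_or_gt t B with h' | h'
    · rw [clamp_eq ⟨h.le, h'⟩]
      have h1 : 𝓝[<] t = 𝓝[Ico A t] t := (nhdsWithin_Ico_eq_nhdsLT h).symm
      rw [h1]
      refine (hlc t ⟨h, h'⟩).congr' ?_
      filter_upwards [self_mem_nhdsWithin] with s hs
      rw [clamp_eq ⟨hs.1, hs.2.le.trans h'⟩]
    · refine Tendsto.congr' ?_ tendsto_const_nhds
      filter_upwards [Ioo_mem_nhdsLT h'] with s hs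
      rw [min_eq_right h'.le, min_eq_right hs.1.le]
  have key' : ∀ t, Function.leftLim hm.stieltjesFunction t = g (max A (min t B)) := by
    intro t
    rw [← key t, ← leftLim_rightLim (hm.tendsto_leftLim t)]
    congr 1
  rw [StieltjesFunction.measure_Ico, key', key']

/-- A finite measure whose mass on closed intervals dominates the increments of `G`. -/
lemma exists_measure_Icc {G : ℝ → ℝ} {A B : ℝ} (hAB : A ≤ B) (hG : MonotoneOn G (Icc A B)) :
    ∃ ν : Measure ℝ, IsFiniteMeasure ν ∧
      ∀ c d, A ≤ c → c ≤ d → d ≤ B → G d - G c ≤ ν.real (Icc c d) := by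
  have hm := monotone_clamp hAB hG
  have hfin := isFiniteMeasure_stieltjes_clamp hAB hG
  refine ⟨_, hfin, fun c d hc hcd hd => ?_⟩
  rw [measureReal_def, ← ENNReal.ofReal_le_iff_le_toReal (measure_ne_top _ _),
    StieltjesFunction.measure_Icc]
  refine ENNReal.ofReal_le_ofReal ?_
  have h1 := hm.le_rightLim (le_refl d)
  have h2 : Function.leftLim hm.stieltjesFunction c ≤ G (max A (min c B)) := by
    have : Function.leftLim hm.stieltjesFunction c =
        Function.leftLim (Function.rightLim fun t => G (max A (min t B))) c := rfl
    rw [this, leftLim_rightLim (hm.tendsto_leftLim c)]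
    exact hm.leftLim_le le_rfl
  rw [clamp_eq ⟨hc, hcd.trans hd⟩] at h2
  simp only [clamp_eq (show d ∈ Icc A B from ⟨hc.trans hcd, hd⟩)] at h1
  rw [Monotone.stieltjesFunction_eq]
  linarith

end Stieltjes

section Superadditive

/-- Sums of integrals of the functions `M (m j)` over the pieces of a subdivision of `[A, t]`. -/
def subdivisionSums (M : ℕ → ℝ → ℝ) (g : ℝ → ℝ) (A t : ℝ) : Set ℝ :=
  {v | ∃ (l : ℕ) (σ : ℕ → ℝ) (m : ℕ → ℕ) (I : ℕ → ℝ), σ 0 = A ∧ σ l = t ∧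
    (∀ j < l, σ j < σ (j + 1)) ∧
    (∀ j < l, HasKSIntegral (M (m j)) g (σ j) (σ (j + 1)) (I j)) ∧
    v = ∑ j ∈ Finset.range l, I j}

variable {M : ℕ → ℝ → ℝ} {g : ℝ → ℝ} {A B : ℝ}

lemma zero_mem_subdivisionSums : (0 : ℝ) ∈ subdivisionSums M g A A :=
  ⟨0, fun _ => A, fun _ => 0, fun _ => 0, rfl, rfl, by simp, by simp, by simp⟩

lemma add_mem_subdivisionSums {s t v J : ℝ} {k : ℕ} (hst : s < t)
    (hv : v ∈ subdivisionSums M g A s) (hJ : HasKSIntegral (M k) g s t J) :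
    v + J ∈ subdivisionSums M g A t := by
  obtain ⟨l, σ, m, I, h0, hl, hσ, hI, rfl⟩ := hv
  refine ⟨l + 1, Function.update σ (l + 1) t, Function.update m l k, Function.update I l J,
    ?_, by simp, ?_, ?_, ?_⟩
  · rw [Function.update_of_ne (by omega), h0]
  · intro j hj
    rw [Function.update_of_ne (by omega)]
    rcases eq_or_ne j l with rfl | hne
    · rw [Function.update_self, hl]; exact hst
    · rw [Function.update_of_ne (by omega)]; exact hσ j (by omega)
  · intro j hj
    rw [Function.update_of_ne (show j ≠ l + 1 by omega)]
    rcases eq_or_ne j l with rfl | hne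
    · rw [Function.update_self, Function.update_self, Function.update_self, hl]; exact hJ
    · rw [Function.update_of_ne (by omega), Function.update_of_ne (by omega),
        Function.update_of_ne (by omega)]
      exact hI j (by omega)
  · rw [Finset.sum_range_succ, Function.update_self]
    congr 1
    refine Finset.sum_congr rfl fun j hj => ?_
    rw [Function.update_of_ne (Finset.mem_range.1 hj).ne]

/-- If sums of integrals over subdivisions are bounded, the integrals are dominated by the
increments of one nondecreasing function. -/
lemma exists_monotoneOn_integral_le (hAB : A < B) {C : ℝ}
    (hM : ∀ k, KSIntegrable (M k) g A B)
    (hnn : ∀ k c d, A ≤ c → c ≤ d → d ≤ B → ∀ I, HasKSIntegral (M k) g c d I → 0 ≤ I)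
    (hC : ∀ (l : ℕ) (σ : ℕ → ℝ) (m : ℕ → ℕ) (I : ℕ → ℝ), 0 < l →
      σ 0 = A → σ l = B → (∀ j < l, σ j < σ (j + 1)) →
      (∀ j < l, HasKSIntegral (M (m j)) g (σ j) (σ (j + 1)) (I j)) →
      ∑ j ∈ Finset.range l, I j ≤ C) :
    ∃ G : ℝ → ℝ, MonotoneOn G (Icc A B) ∧ ∀ k c d, A ≤ c → c ≤ d → d ≤ B →
      ∀ I, HasKSIntegral (M k) g c d I → I ≤ G d - G c := by
  have hB : ∀ v ∈ subdivisionSums M g A B, v ≤ C := by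
    rintro v ⟨l, σ, m, I, h0, hl, hσ, hI, rfl⟩
    refine hC l σ m I (Nat.pos_of_ne_zero ?_) h0 hl hσ hI
    rintro rfl
    exact hAB.ne (h0.symm.trans hl)
  have hbdd : ∀ t ∈ Icc A B, ∀ v ∈ subdivisionSums M g A t, v ≤ C := by
    intro t ht v hv
    rcases ht.2.eq_or_lt with rfl | h
    · exact hB v hv
    · obtain ⟨J, hJ⟩ := (hM 0).mono ht.1 ht.2 le_rfl
      have h1 := hB _ (add_mem_subdivisionSums h hv hJ)
      linarith [hnn 0 t B ht.1 ht.2 le_rfl J hJ]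
  have hne : ∀ t ∈ Icc A B, (subdivisionSums M g A t).Nonempty := by
    intro t ht
    rcases ht.1.eq_or_lt with rfl | h
    · exact ⟨0, zero_mem_subdivisionSums⟩
    · obtain ⟨J, hJ⟩ := (hM 0).mono le_rfl ht.1 ht.2
      exact ⟨_, add_mem_subdivisionSums h zero_mem_subdivisionSums hJ⟩
  have key : ∀ k c d, A ≤ c → c ≤ d → d ≤ B → ∀ I, HasKSIntegral (M k) g c d I →
      I ≤ sSup (subdivisionSums M g A d) - sSup (subdivisionSums M g A c) := by
    intro k c d hc hcd hd I hI
    rcases hcd.eq_or_lt with rfl | h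
    · have := HasKSIntegral.append le_rfl le_rfl hI hI hI
      linarith
    · have : sSup (subdivisionSums M g A c) ≤ sSup (subdivisionSums M g A d) - I := by
        refine csSup_le (hne c ⟨hc, hcd.trans hd⟩) fun v hv => ?_
        have := le_csSup (a := v + I) ⟨C, hbdd d ⟨hc.trans hcd, hd⟩⟩
          (add_mem_subdivisionSums h hv hI)
        linarith
      linarith
  refine ⟨_, fun c hc d hd hcd => ?_, key⟩
  obtain ⟨J, hJ⟩ := (hM 0).mono hc.1 hcd hd.2
  linarith [key 0 c d hc.1 hcd hd.2 J hJ, hnn 0 c d hc.1 hcd hd.2 J hJ]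

end Superadditive

section Coordinates

lemma abs_apply_le_norm {n : ℕ} (u : En n) (i : Fin n) : |u i| ≤ ‖u‖ := by
  simpa using PiLp.norm_apply_le u i

lemma norm_le_of_abs_apply_le {n : ℕ} {u : En n} {r : ℝ} (h : ∀ i, |u i| ≤ r) :
    ‖u‖ ≤ n * r := by
  have h1 : u = ∑ i, EuclideanSpace.single i (u i) := by
    ext j
    simp [Finset.sum_apply, Pi.single_apply]
  rw [h1]
  refine (norm_sum_le _ _).trans ?_
  calc ∑ i, ‖EuclideanSpace.single i (u i)‖ ≤ ∑ _i : Fin n, r :=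
        Finset.sum_le_sum fun i _ => by simpa using h i
    _ = n * r := by simp

lemma TaggedPartition.sum_apply {n : ℕ} {c d : ℝ} (P : TaggedPartition c d) (F : ℝ → En n)
    (g : ℝ → ℝ) (i : Fin n) : (P.sum F g) i = P.sum (fun s => F s i) g := by
  simp [TaggedPartition.sum]

lemma HasKSIntegral.apply {n : ℕ} {F : ℝ → En n} {g : ℝ → ℝ} {c d : ℝ} {I : En n}
    (h : HasKSIntegral F g c d I) (i : Fin n) : HasKSIntegral (fun s => F s i) g c d (I i) := by
  intro ε hε
  obtain ⟨δ, h1, h2⟩ := h ε hε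
  refine ⟨δ, h1, fun P hP => lt_of_le_of_lt ?_ (h2 P hP)⟩
  rw [← P.sum_apply, Real.norm_eq_abs]
  exact abs_apply_le_norm (P.sum F g - I) i

lemma hasKSIntegral_of_apply {n : ℕ} {F : ℝ → En n} {g : ℝ → ℝ} {c d : ℝ} {I : En n}
    (h : ∀ i, HasKSIntegral (fun s => F s i) g c d (I i)) : HasKSIntegral F g c d I := by
  intro ε hε
  have hη : 0 < ε / (n + 1) := by positivity
  choose δ h1 h2 using fun i => h i _ hη
  obtain ⟨δ', h1', h2'⟩ : ∃ δ' : ℝ → ℝ, (∀ t, 0 < δ' t) ∧ ∀ i t, δ' t ≤ δ i t := by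
    have : ∀ t, ∃ r > (0 : ℝ), ∀ i, r ≤ δ i t := fun t => by
      have h3 : ∀ᶠ r in 𝓝[>] (0 : ℝ), ∀ i, r ≤ δ i t :=
        eventually_all.2 fun i => mem_of_superset (Ioc_mem_nhdsGT (h1 i t)) fun r hr => hr.2
      obtain ⟨r, hr, hr'⟩ := (h3.and self_mem_nhdsWithin).exists
      exact ⟨r, hr', hr⟩
    choose δ' h1' h2' using this
    exact ⟨δ', h1', fun i t => h2' t i⟩
  refine ⟨δ', h1', fun P hP => ?_⟩
  have h3 : ∀ i, |(P.sum F g - I) i| ≤ ε / (n + 1) := fun i => by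
    have := h2 i P fun j hj => (hP j hj).trans
      (Ioo_subset_Ioo (by linarith [h2' i (P.τ j)]) (by linarith [h2' i (P.τ j)]))
    rw [← P.sum_apply, Real.norm_eq_abs] at this
    exact this.le
  refine (norm_le_of_abs_apply_le h3).trans_lt ?_
  rw [mul_div_assoc', div_lt_iff₀ (by positivity)]
  nlinarith

lemma hasKSIntegral_neg {F g : ℝ → ℝ} {c d I : ℝ} (h : HasKSIntegral F g c d I) :
    HasKSIntegral (fun s => -F s) g c d (-I) := by
  intro ε hε
  obtain ⟨δ, h1, h2⟩ := h ε hε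
  refine ⟨δ, h1, fun P hP => ?_⟩
  have : P.sum (fun s => -F s) g - -I = -(P.sum F g - I) := by
    simp only [TaggedPartition.sum, smul_neg, Finset.sum_neg_distrib]; ring
  rw [this, norm_neg]
  exact h2 P hP

end Coordinates

section Domination

open MeasureTheory

variable {n : ℕ} {μ : Measure ℝ} [IsFiniteMeasure μ] {g : ℝ → ℝ} {A B : ℝ}

/-- Families whose integrals are dominated by the increments of one nondecreasing function have
a common Lebesgue integrable dominating function. -/
lemma exists_integrable_dominator (hAB : A < B) (hg : Monotone g)
    (hμ : ∀ a b, a ≤ b → μ (Ico a b) = ENNReal.ofReal (g b - g a))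
    {f : ℕ → ℝ → En n → En n} {G : ℝ → ℝ} (hG : MonotoneOn G (Icc A B))
    (hcont : ∀ k, ∀ t ∈ Icc A B, Continuous (f k t))
    (hint : ∀ k u, KSIntegrable (fun s => f k s u) g A B)
    (hdom : ∀ k u c d, A ≤ c → c ≤ d → d ≤ B → ∀ I, HasKSIntegral (fun s => f k s u) g c d I →
      ‖I‖ ≤ G d - G c) :
    ∃ ρ : ℝ → ℝ, Integrable ρ μ ∧ (∀ t, 0 ≤ ρ t) ∧
      ∀ᵐ t ∂μ, t ∈ Ico A B → ∀ k u, ‖f k t u‖ ≤ ρ t := by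
  obtain ⟨ν, hνfin, hν⟩ := exists_measure_Icc hAB.le hG
  refine ⟨fun t => n * (2 * (ν.rnDeriv μ t).toReal),
    (Measure.integrable_toReal_rnDeriv.const_mul 2).const_mul _, fun t => by positivity, ?_⟩
  have key : ∀ k u i, ∀ᵐ t ∂μ, t ∈ Ico A B → |f k t u i| ≤ 2 * (ν.rnDeriv μ t).toReal := by
    intro k u i
    obtain ⟨Ψ, hΨ⟩ := (hint k u).exists_indefinite
    have hle : ∀ c d, A ≤ c → c ≤ d → d ≤ B → |Ψ d i - Ψ c i| ≤ ν.real (Icc c d) :=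
      fun c d hc hcd hd => (abs_apply_le_norm (Ψ d - Ψ c) i).trans
        ((hdom k u c d hc hcd hd _ (hΨ c d hc hcd hd)).trans (hν c d hc hcd hd))
    have h1 := ae_le_rnDeriv (ν := ν) (H := fun t => f k t u i) (Ψ := fun t => Ψ t i) hAB hg hμ
      (fun c d hc hcd hd => (hΨ c d hc hcd hd).apply i)
      (fun c d hc hcd hd => (le_abs_self _).trans (hle c d hc hcd hd))
    have h2 := ae_le_rnDeriv (ν := ν) (H := fun t => -f k t u i) (Ψ := fun t => -Ψ t i) hAB hg hμ
      (fun c d hc hcd hd => by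
        convert hasKSIntegral_neg ((hΨ c d hc hcd hd).apply i) using 1
        simp only [PiLp.sub_apply]; ring)
      (fun c d hc hcd hd => by
        refine le_trans ?_ (hle c d hc hcd hd)
        linarith [neg_le_abs (Ψ d i - Ψ c i)])
    filter_upwards [h1, h2] with t h1 h2 ht
    exact abs_le.2 ⟨by linarith [h2 ht], h1 ht⟩
  have key' : ∀ᵐ t ∂μ, ∀ k j i, t ∈ Ico A B →
      |f k t (TopologicalSpace.denseSeq (En n) j) i| ≤ 2 * (ν.rnDeriv μ t).toReal :=
    ae_all_iff.2 fun k => ae_all_iff.2 fun j => ae_all_iff.2 fun i => key k _ i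
  filter_upwards [key'] with t ht htI k
  have hclosed : IsClosed {u | ‖f k t u‖ ≤ n * (2 * (ν.rnDeriv μ t).toReal)} :=
    isClosed_le (hcont k t (Ico_subset_Icc_self htI)).norm continuous_const
  have hsub : range (TopologicalSpace.denseSeq (En n)) ⊆
      {u | ‖f k t u‖ ≤ n * (2 * (ν.rnDeriv μ t).toReal)} := by
    rintro _ ⟨j, rfl⟩
    exact norm_le_of_abs_apply_le fun i => ht k j i htI
  intro u
  exact closure_minimal hsub hclosed (TopologicalSpace.denseRange_denseSeq (En n) u)

lemma integral_apply_En {κ : Measure ℝ} {F : ℝ → En n} {S : Set ℝ} (hF : IntegrableOn F S κ)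
    (i : Fin n) : (∫ x in S, F x ∂κ) i = ∫ x in S, F x i ∂κ :=
  ((EuclideanSpace.proj (𝕜 := ℝ) i).integral_comp_comm hF).symm

lemma hasKSIntegral_of_integrableOn_En (hg : Monotone g)
    (hμ : ∀ a b, a ≤ b → μ (Ico a b) = ENNReal.ofReal (g b - g a))
    {F : ℝ → En n} {c d : ℝ} (hcd : c ≤ d) (hF : IntegrableOn F (Ico c d) μ) :
    HasKSIntegral F g c d (∫ x in Ico c d, F x ∂μ) := by
  refine hasKSIntegral_of_apply fun i => ?_
  rw [integral_apply_En hF]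
  exact hasKSIntegral_of_integrableOn hμ hg hcd
    ((EuclideanSpace.proj (𝕜 := ℝ) i).integrable_comp hF)

/-- A Kurzweil–Stieltjes integrable function with an integrable dominating function is Lebesgue
integrable. -/
lemma integrableOn_of_ksIntegrable (hAB : A < B) (hg : Monotone g)
    (hμ : ∀ a b, a ≤ b → μ (Ico a b) = ENNReal.ofReal (g b - g a))
    {F : ℝ → En n} (hF : KSIntegrable F g A B) {ρ : ℝ → ℝ} (hρ : Integrable ρ μ)
    (hle : ∀ᵐ t ∂μ, t ∈ Ico A B → ‖F t‖ ≤ ρ t) : IntegrableOn F (Ico A B) μ := by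
  obtain ⟨Ψ, hΨ⟩ := hF.exists_indefinite
  have hmeas : AEMeasurable (fun t i => F t i) (μ.restrict (Ico A B)) :=
    aemeasurable_pi_lambda _ fun i =>
      aemeasurable_of_hasKSIntegral (H := fun t => F t i) (Ψ := fun t => Ψ t i) hAB hg hμ
        fun c d hc hcd hd => (hΨ c d hc hcd hd).apply i
  have hmeas' : AEMeasurable F (μ.restrict (Ico A B)) :=
    (MeasurableEquiv.toLp 2 (Fin n → ℝ)).measurable.comp_aemeasurable hmeas
  exact hρ.restrict.mono' hmeas'.aestronglyMeasurable
    ((ae_restrict_iff' measurableSet_Ico).2 hle)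

end Domination

section Regulated

variable {E : Type*} [NormedAddCommGroup E] {A B : ℝ}

/-- The one-sided neighbourhood filters of `[A, B]`. -/
def sideFilters (A B : ℝ) : Set (Filter ℝ) :=
  {l | (∃ τ ∈ Ioc A B, l = 𝓝[Ico A τ] τ) ∨ ∃ τ ∈ Ico A B, l = 𝓝[Ioc τ B] τ}

lemma neBot_of_mem_sideFilters {l : Filter ℝ} (hl : l ∈ sideFilters A B) : l.NeBot := by
  rcases hl with ⟨τ, hτ, rfl⟩ | ⟨τ, hτ, rfl⟩
  · rw [nhdsWithin_Ico_eq_nhdsLT hτ.1]; infer_instance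
  · rw [nhdsWithin_Ioc_eq_nhdsGT hτ.2]; infer_instance

lemma Icc_mem_of_mem_sideFilters {l : Filter ℝ} (hl : l ∈ sideFilters A B) : Icc A B ∈ l := by
  rcases hl with ⟨τ, hτ, rfl⟩ | ⟨τ, hτ, rfl⟩
  · exact mem_of_superset self_mem_nhdsWithin fun t ht => ⟨ht.1, ht.2.le.trans hτ.2⟩
  · exact mem_of_superset self_mem_nhdsWithin fun t ht => ⟨hτ.1.trans ht.1.le, ht.2⟩

lemma regulatedOn_iff_tendsto {f : ℝ → E} :
    RegulatedOn f A B ↔ ∀ l ∈ sideFilters A B, ∃ L, Tendsto f l (𝓝 L) := by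
  constructor
  · rintro ⟨h1, h2⟩ l (⟨τ, hτ, rfl⟩ | ⟨τ, hτ, rfl⟩)
    exacts [h1 τ hτ, h2 τ hτ]
  · exact fun h => ⟨fun τ hτ => h _ (Or.inl ⟨τ, hτ, rfl⟩), fun τ hτ => h _ (Or.inr ⟨τ, hτ, rfl⟩)⟩

lemma RegulatedOn.exists_norm_sub_le {f : ℝ → E} (h : RegulatedOn f A B) {l : Filter ℝ}
    (hl : l ∈ sideFilters A B) {ε : ℝ} (hε : 0 < ε) :
    ∃ S ∈ l, ∀ s ∈ S, ∀ t ∈ S, ‖f s - f t‖ ≤ ε := by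
  obtain ⟨L, hL⟩ := regulatedOn_iff_tendsto.1 h l hl
  refine ⟨f ⁻¹' Metric.ball L (ε / 2), hL (Metric.ball_mem_nhds L (half_pos hε)), fun s hs t ht => ?_⟩
  rw [← dist_eq_norm]
  have := dist_triangle_right (f s) (f t) L
  have h1 : dist (f s) L < ε / 2 := hs
  have h2 : dist (f t) L < ε / 2 := ht
  linarith

lemma regulatedOn_of_norm_sub_le [CompleteSpace E] {f : ℝ → E}
    (h : ∀ l ∈ sideFilters A B, ∀ ε > 0, ∃ S ∈ l, ∀ s ∈ S, ∀ t ∈ S, ‖f s - f t‖ ≤ ε) :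
    RegulatedOn f A B := by
  refine regulatedOn_iff_tendsto.2 fun l hl => ?_
  have := neBot_of_mem_sideFilters hl
  refine cauchy_map_iff_exists_tendsto.1 (Metric.cauchy_iff.2 ⟨inferInstance, fun ε hε => ?_⟩)
  obtain ⟨S, hS, hS'⟩ := h l hl (ε / 2) (half_pos hε)
  refine ⟨f '' S, image_mem_map hS, ?_⟩
  rintro _ ⟨s, hs, rfl⟩ _ ⟨t, ht, rfl⟩
  rw [dist_eq_norm]
  linarith [hS' s hs t ht]

/-- A function approximated uniformly by regulated functions is regulated. -/
lemma regulatedOn_of_approx [CompleteSpace E] {f : ℝ → E}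
    (h : ∀ ε > 0, ∃ f' : ℝ → E, RegulatedOn f' A B ∧ ∀ t ∈ Icc A B, ‖f' t - f t‖ ≤ ε) :
    RegulatedOn f A B := by
  refine regulatedOn_of_norm_sub_le fun l hl ε hε => ?_
  obtain ⟨f', hf', hff'⟩ := h (ε / 3) (by positivity)
  obtain ⟨S, hS, hS'⟩ := hf'.exists_norm_sub_le hl (show 0 < ε / 3 by positivity)
  refine ⟨S ∩ Icc A B, inter_mem hS (Icc_mem_of_mem_sideFilters hl), fun s hs t ht => ?_⟩
  have h1 := hff' s hs.2
  have h2 := hff' t ht.2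
  have h3 := hS' s hs.1 t ht.1
  have : f s - f t = -(f' s - f s) + (f' s - f' t) + (f' t - f t) := by abel
  rw [this]
  refine (norm_add₃_le).trans ?_
  rw [norm_neg]
  linarith

lemma regulatedOn_of_monotoneOn {G : ℝ → ℝ} (hAB : A ≤ B) (hG : MonotoneOn G (Icc A B)) :
    RegulatedOn G A B := by
  have hm := monotone_clamp hAB hG
  have heq : ∀ l ∈ sideFilters A B, (fun t => G (max A (min t B))) =ᶠ[l] G := fun l hl =>
    mem_of_superset (Icc_mem_of_mem_sideFilters hl) fun t ht => by
      simp only [mem_ofPred_eq, clamp_eq ht]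
  refine regulatedOn_iff_tendsto.2 fun l hl => ?_
  have heq := heq l hl
  rcases hl with ⟨τ, hτ, rfl⟩ | ⟨τ, hτ, rfl⟩
  · exact ⟨_, ((hm.tendsto_leftLim τ).mono_left
      (nhdsWithin_mono _ Ico_subset_Iio_self)).congr' heq⟩
  · exact ⟨_, ((hm.tendsto_rightLim τ).mono_left
      (nhdsWithin_mono _ Ioc_subset_Ioi_self)).congr' heq⟩

/-- A compactness principle for `[A, B]` in terms of one-sided neighbourhoods. -/
lemma induction_on_sideFilters {p : Set ℝ → Prop} (he : p ∅)
    (hmono : ∀ S T, S ⊆ T → p T → p S) (hunion : ∀ S T, p S → p T → p (S ∪ T))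
    (hside : ∀ l ∈ sideFilters A B, ∃ S ∈ l, p S) (hpt : ∀ τ ∈ Icc A B, p {τ}) :
    p (Icc A B) := by
  refine isCompact_Icc.induction_on he hmono hunion fun τ hτ => ?_
  obtain ⟨S, hS, hpS⟩ : ∃ S ∈ 𝓝[Ico A τ] τ, p S := by
    rcases hτ.1.eq_or_lt with rfl | h
    · exact ⟨∅, by simp, he⟩
    · exact hside _ (Or.inl ⟨τ, ⟨h, hτ.2⟩, rfl⟩)
  obtain ⟨T, hT, hpT⟩ : ∃ S ∈ 𝓝[Ioc τ B] τ, p S := by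
    rcases hτ.2.eq_or_lt with rfl | h
    · exact ⟨∅, by simp, he⟩
    · exact hside _ (Or.inr ⟨τ, ⟨hτ.1, h⟩, rfl⟩)
  refine ⟨S ∪ {τ} ∪ T, ?_, hunion _ _ (hunion _ _ hpS (hpt τ hτ)) hpT⟩
  have : Icc A B = Ico A τ ∪ {τ} ∪ Ioc τ B := by
    ext t
    simp only [mem_Icc, mem_union, mem_Ico, mem_singleton_iff, mem_Ioc]
    constructor
    · intro ht
      rcases lt_trichotomy t τ with h | h | h
      · exact Or.inl (Or.inl ⟨ht.1, h⟩)
      · exact Or.inl (Or.inr h)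
      · exact Or.inr ⟨h, ht.2⟩
    · rintro ((h | rfl) | h)
      exacts [⟨h.1, h.2.le.trans hτ.2⟩, hτ, ⟨hτ.1.trans h.1.le, h.2⟩]
  rw [this, nhdsWithin_union, nhdsWithin_union, nhdsWithin_singleton]
  exact union_mem_sup (union_mem_sup hS (by simp)) hT

lemma RegulatedOn.exists_norm_le {f : ℝ → E} (h : RegulatedOn f A B) :
    ∃ C, ∀ t ∈ Icc A B, ‖f t‖ ≤ C := by
  refine induction_on_sideFilters (p := fun S => ∃ C, ∀ t ∈ S, ‖f t‖ ≤ C) ⟨0, by simp⟩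
    (fun S T hST ⟨C, hC⟩ => ⟨C, fun t ht => hC t (hST ht)⟩) ?_ ?_ fun τ _ => ⟨‖f τ‖, by simp⟩
  · rintro S T ⟨C, hC⟩ ⟨C', hC'⟩
    refine ⟨max C C', fun t ht => ?_⟩
    rcases ht with ht | ht
    exacts [(hC t ht).trans (le_max_left _ _), (hC' t ht).trans (le_max_right _ _)]
  · intro l hl
    have := neBot_of_mem_sideFilters hl
    obtain ⟨S, hS, hS'⟩ := h.exists_norm_sub_le hl one_pos
    obtain ⟨s, hs⟩ := Filter.nonempty_of_mem hS
    refine ⟨S, hS, ‖f s‖ + 1, fun t ht => ?_⟩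
    have := norm_le_norm_add_norm_sub' (f t) (f s)
    linarith [hS' t ht s hs]

/-- A Helly-type selection principle: bounded, asymptotically equiregulated sequences have
uniformly convergent subsequences. -/
lemma exists_subseq_tendstoUniformlyOn [ProperSpace E] {x : ℕ → ℝ → E} {r : ℝ} {K₀ : ℕ}
    (hb : ∀ k ≥ K₀, ∀ t ∈ Icc A B, ‖x k t‖ ≤ r)
    (hosc : ∀ l ∈ sideFilters A B, ∀ ε > 0, ∃ S ∈ l, ∃ K, ∀ k ≥ K, ∀ s ∈ S, ∀ t ∈ S,
      ‖x k s - x k t‖ ≤ ε) :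
    ∃ ψ : ℕ → ℕ, StrictMono ψ ∧ ∃ y : ℝ → E,
      TendstoUniformlyOn (fun j => x (ψ j)) y atTop (Icc A B) := by
  have net : ∀ ε > 0, ∃ D ⊆ Icc A B, D.Finite ∧ ∃ K, ∀ t ∈ Icc A B, ∃ d ∈ D, ∀ k ≥ K,
      ‖x k t - x k d‖ ≤ ε := by
    intro ε hε
    refine induction_on_sideFilters (p := fun S => ∃ D ⊆ Icc A B, D.Finite ∧ ∃ K, ∀ t ∈ S,
      ∃ d ∈ D, ∀ k ≥ K, ‖x k t - x k d‖ ≤ ε) ⟨∅, by simp⟩ ?_ ?_ ?_ ?_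
    · rintro S T hST ⟨D, hD, hDf, K, hK⟩
      exact ⟨D, hD, hDf, K, fun t ht => hK t (hST ht)⟩
    · rintro S T ⟨D, hD, hDf, K, hK⟩ ⟨D', hD', hDf', K', hK'⟩
      refine ⟨D ∪ D', union_subset hD hD', hDf.union hDf', max K K', ?_⟩
      rintro t (ht | ht)
      · obtain ⟨d, hd, h⟩ := hK t ht
        exact ⟨d, Or.inl hd, fun k hk => h k ((le_max_left _ _).trans hk)⟩
      · obtain ⟨d, hd, h⟩ := hK' t ht
        exact ⟨d, Or.inr hd, fun k hk => h k ((le_max_right _ _).trans hk)⟩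
    · intro l hl
      have := neBot_of_mem_sideFilters hl
      obtain ⟨S, hS, K, hK⟩ := hosc l hl ε hε
      obtain ⟨s, hs, hs'⟩ := Filter.nonempty_of_mem (inter_mem hS (Icc_mem_of_mem_sideFilters hl))
      exact ⟨S, hS, {s}, by simpa using hs', finite_singleton s, K, fun t ht =>
        ⟨s, rfl, fun k hk => hK k hk t ht s hs⟩⟩
    · intro τ hτ
      exact ⟨{τ}, by simpa using hτ, finite_singleton τ, 0, by simpa using hε.le⟩
  choose D hD hDf K hK using fun m : ℕ => net (1 / (m + 1)) Nat.one_div_pos_of_nat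
  set Q : Set ℝ := ⋃ m, D m
  have : Countable Q := (countable_iUnion fun m => (hDf m).countable).to_subtype
  have hmem : ∀ k, (fun d : Q => x (k + K₀) d) ∈
      univ.pi fun _ : Q => Metric.closedBall (0 : E) r := by
    intro k d _
    obtain ⟨m, hm⟩ := mem_iUnion.1 d.2
    simpa using hb (k + K₀) (by omega) d (hD m hm)
  obtain ⟨z, -, ψ, hψ, hz⟩ :=
    (isCompact_univ_pi fun _ : Q => isCompact_closedBall (0 : E) r).tendsto_subseq hmem
  rw [tendsto_pi_nhds] at hz
  have hψ' : StrictMono fun j => ψ j + K₀ := fun i j hij => Nat.add_lt_add_right (hψ hij) _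
  have hcauchy : UniformCauchySeqOn (fun j => x (ψ j + K₀)) atTop (Icc A B) := by
    refine Metric.uniformCauchySeqOn_iff.2 fun ε hε => ?_
    obtain ⟨m, hm⟩ := exists_nat_one_div_lt (show 0 < ε / 4 by positivity)
    have h1 : ∀ᶠ j in atTop, ∀ d (hd : d ∈ D m),
        dist (x (ψ j + K₀) d) (z ⟨d, mem_iUnion.2 ⟨m, hd⟩⟩) < ε / 4 := by
      have := (hDf m).to_subtype
      have h2 : ∀ᶠ j in atTop, ∀ d : D m,
          dist (x (ψ j + K₀) d) (z ⟨d, mem_iUnion.2 ⟨m, d.2⟩⟩) < ε / 4 :=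
        eventually_all.2 fun d => (hz ⟨d, mem_iUnion.2 ⟨m, d.2⟩⟩).eventually
          (Metric.ball_mem_nhds _ (by positivity))
      exact h2.mono fun j h d hd => h ⟨d, hd⟩
    obtain ⟨N, hN⟩ := eventually_atTop.1 (h1.and (hψ'.tendsto_atTop.eventually_ge_atTop (K m)))
    refine ⟨N, fun i hi j hj t ht => ?_⟩
    obtain ⟨d, hd, hdt⟩ := hK m t ht
    have e1 := hdt _ (hN i hi).2
    have e2 := hdt _ (hN j hj).2
    have e3 := (hN i hi).1 d hd
    have e4 := (hN j hj).1 d hd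
    rw [← dist_eq_norm] at e1 e2
    have t1 := dist_triangle (x (ψ i + K₀) t) (x (ψ i + K₀) d) (x (ψ j + K₀) t)
    have t2 := dist_triangle_right (x (ψ i + K₀) d) (x (ψ j + K₀) t) (x (ψ j + K₀) d)
    have t3 := dist_triangle_right (x (ψ i + K₀) d) (x (ψ j + K₀) d)
      (z ⟨d, mem_iUnion.2 ⟨m, hd⟩⟩)
    linarith
  have hlim : ∀ t, t ∈ Icc A B → ∃ y, Tendsto (fun j => x (ψ j + K₀) t) atTop (𝓝 y) :=
    fun t ht => cauchySeq_tendsto_of_complete (hcauchy.cauchySeq ht)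
  choose! y hy using hlim
  exact ⟨_, hψ', y, hcauchy.tendstoUniformlyOn_of_tendsto hy⟩

end Regulated

section Hybrid

variable {E : Type*} [NormedAddCommGroup E] {A B : ℝ} {h : ℝ → E → E} {hk : ℕ → ℝ → E → E}

lemma norm_limit_sub_le
    (hlim : ∀ r : ℝ, 0 < r → ∀ ε : ℝ, 0 < ε → ∃ K : ℕ, ∀ k ≥ K,
      ∀ t ∈ Icc A B, ∀ u : E, ‖u‖ ≤ r → ‖hk k t u - h t u‖ ≤ ε)
    (hlip : ∀ k, ∀ t ∈ Icc A B, ∀ u v : E, ‖hk k t u - hk k t v‖ ≤ ‖u - v‖)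
    {t : ℝ} (ht : t ∈ Icc A B) (u v : E) : ‖h t u - h t v‖ ≤ ‖u - v‖ := by
  refine le_of_forall_pos_le_add fun ε hε => ?_
  obtain ⟨K, hK⟩ := hlim (max ‖u‖ ‖v‖ + 1) (by positivity) (ε / 2) (by positivity)
  have h1 := hK K le_rfl t ht u ((le_max_left _ _).trans (by linarith))
  have h2 := hK K le_rfl t ht v ((le_max_right _ _).trans (by linarith))
  have h3 := hlip K t ht u v
  have : h t u - h t v = -(hk K t u - h t u) + (hk K t u - hk K t v) + (hk K t v - h t v) := by
    abel
  rw [this]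
  refine norm_add₃_le.trans ?_
  rw [norm_neg]
  linarith

lemma regulatedOn_limit [CompleteSpace E]
    (hlim : ∀ r : ℝ, 0 < r → ∀ ε : ℝ, 0 < ε → ∃ K : ℕ, ∀ k ≥ K,
      ∀ t ∈ Icc A B, ∀ u : E, ‖u‖ ≤ r → ‖hk k t u - h t u‖ ≤ ε)
    (hreg : ∀ k (v : E), RegulatedOn (fun t => hk k t v) A B) (v : E) :
    RegulatedOn (fun t => h t v) A B := by
  refine regulatedOn_of_approx fun ε hε => ?_
  obtain ⟨K, hK⟩ := hlim (‖v‖ + 1) (by positivity) ε hε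
  exact ⟨_, hreg K v, fun t ht => hK K le_rfl t ht v (by linarith)⟩

/-- Regulated, uniformly Lipschitz families oscillate little near each side of a point, uniformly
on bounded sets. -/
lemma exists_norm_sub_le_of_lipschitz [ProperSpace E]
    (hlip : ∀ t ∈ Icc A B, ∀ u v : E, ‖h t u - h t v‖ ≤ ‖u - v‖)
    (hreg : ∀ v : E, RegulatedOn (fun t => h t v) A B) {l : Filter ℝ}
    (hl : l ∈ sideFilters A B) (r : ℝ) {ε : ℝ} (hε : 0 < ε) :
    ∃ S ∈ l, S ⊆ Icc A B ∧ ∀ s ∈ S, ∀ t ∈ S, ∀ u : E, ‖u‖ ≤ r → ‖h s u - h t u‖ ≤ ε := by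
  obtain ⟨T, -, hTf, hT⟩ := Metric.totallyBounded_iff.1
    (isCompact_closedBall (0 : E) r).totallyBounded (ε / 3) (by positivity) |>.imp
      fun T hT => (⟨trivial, hT.1, hT.2⟩ : True ∧ _ ∧ _)
  choose S hS hS' using fun v => (hreg v).exists_norm_sub_le hl (show 0 < ε / 3 by positivity)
  refine ⟨(⋂ v ∈ T, S v) ∩ Icc A B, inter_mem ((biInter_mem hTf).2 fun v _ => hS v)
    (Icc_mem_of_mem_sideFilters hl), inter_subset_right, fun s hs t ht u hu => ?_⟩
  obtain ⟨v, hv, huv⟩ : ∃ v ∈ T, dist u v < ε / 3 := by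
    simpa using hT (show u ∈ Metric.closedBall (0 : E) r by simpa using hu)
  rw [dist_eq_norm] at huv
  have h1 := hS' v s (mem_iInter₂.1 hs.1 v hv) t (mem_iInter₂.1 ht.1 v hv)
  have h2 := hlip s hs.2 u v
  have h3 := hlip t ht.2 u v
  have : h s u - h t u = (h s u - h s v) + (h s v - h t v) + -(h t u - h t v) := by abel
  rw [this]
  refine norm_add₃_le.trans ?_
  rw [norm_neg]
  linarith

variable {φ : ℕ → ℝ → ℝ} {x I : ℕ → ℝ → E} {xhat : ℕ → E} {Γ : ℝ → ℝ}

/-- Solutions are bounded when `φ k` is eventually strictly sublinear. -/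
lemma exists_norm_solution_le [CompleteSpace E] (hAB : A ≤ B)
    (hlim : ∀ r : ℝ, 0 < r → ∀ ε : ℝ, 0 < ε → ∃ K : ℕ, ∀ k ≥ K,
      ∀ t ∈ Icc A B, ∀ u : E, ‖u‖ ≤ r → ‖hk k t u - h t u‖ ≤ ε)
    (hlip : ∀ k, ∀ t ∈ Icc A B, ∀ u v : E, ‖hk k t u - hk k t v‖ ≤ ‖u - v‖)
    (hφ : ∀ k, ∀ t ∈ Icc A B, ∀ u v : E, ‖hk k t u - hk k t v‖ ≤ φ k ‖u - v‖)
    (hreg : ∀ k (v : E), RegulatedOn (fun t => hk k t v) A B)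
    {x₀ : E} (hx₀ : Tendsto xhat atTop (𝓝 x₀))
    (hΓ : MonotoneOn Γ (Icc A B))
    (hI : ∀ k, ∀ s ∈ Icc A B, ∀ t ∈ Icc A B, ‖I k t - I k s‖ ≤ |Γ t - Γ s|)
    (hxA : ∀ k, x k A = xhat k)
    (hx : ∀ k, ∀ t ∈ Icc A B, x k t = xhat k - hk k A (xhat k) + hk k t (x k t) + I k t)
    {R q : ℝ} (hq : q < 1) (hR : ∀ k, ∀ r ≥ R, φ k r ≤ q * r) :
    ∃ r, ∃ K, ∀ k ≥ K, ∀ t ∈ Icc A B, ‖x k t‖ ≤ r := by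
  have hA : A ∈ Icc A B := left_mem_Icc.2 hAB
  obtain ⟨C, hC⟩ := (regulatedOn_limit hlim hreg x₀).exists_norm_le
  obtain ⟨K, hK⟩ := hlim (‖x₀‖ + 1) (by positivity) 1 one_pos
  obtain ⟨K', hK'⟩ := Metric.tendsto_atTop.1 hx₀ 1 one_pos
  set b := 2 * (C + 2) + (Γ B - Γ A) with hb
  refine ⟨‖x₀‖ + 1 + max R (b / (1 - q)), max K K', fun k hk' t ht => ?_⟩
  have hxh : ‖xhat k - x₀‖ ≤ 1 := by
    rw [← dist_eq_norm]; exact (hK' k ((le_max_right _ _).trans hk')).le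
  have hbd : ∀ s ∈ Icc A B, ‖hk k s (xhat k)‖ ≤ C + 2 := by
    intro s hs
    have e1 := hlip k s hs (xhat k) x₀
    have e2 := hK k ((le_max_left _ _).trans hk') s hs x₀ (by linarith)
    have e3 := hC s hs
    have : hk k s (xhat k) = (hk k s (xhat k) - hk k s x₀) + (hk k s x₀ - h s x₀) + h s x₀ := by
      abel
    rw [this]
    refine norm_add₃_le.trans ?_
    linarith
  have hI0 : I k A = 0 := by
    have := hx k A hA
    rw [hxA] at this
    simpa using this
  have hIt : ‖I k t‖ ≤ Γ B - Γ A := by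
    have e1 := hI k A hA t ht
    rw [hI0, sub_zero, abs_of_nonneg (sub_nonneg.2 (hΓ hA ht ht.1))] at e1
    linarith [hΓ ht (right_mem_Icc.2 hAB) ht.2]
  have hmain : ‖x k t - xhat k‖ ≤ φ k ‖x k t - xhat k‖ + b := by
    have e : x k t - xhat k = (hk k t (x k t) - hk k t (xhat k)) +
        (hk k t (xhat k) - hk k A (xhat k)) + I k t := by
      nth_rw 1 [hx k t ht]; abel
    nth_rw 1 [e]
    refine norm_add₃_le.trans ?_
    have e1 := hφ k t ht (x k t) (xhat k)
    have e2 := norm_sub_le (hk k t (xhat k)) (hk k A (xhat k))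
    linarith [hbd t ht, hbd A hA]
  have hfin : ‖x k t - xhat k‖ ≤ max R (b / (1 - q)) := by
    rcases le_total ‖x k t - xhat k‖ R with h' | h'
    · exact h'.trans (le_max_left _ _)
    · refine le_trans ?_ (le_max_right _ _)
      rw [le_div_iff₀ (by linarith)]
      linarith [hR k _ h']
  have e1 : x k t = (x k t - xhat k) + (xhat k - x₀) + x₀ := by abel
  rw [e1]
  refine norm_add₃_le.trans ?_
  linarith

/-- Bounded solutions are asymptotically equiregulated. -/
lemma exists_norm_solution_sub_le [ProperSpace E] (hAB : A ≤ B)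
    (hlim : ∀ r : ℝ, 0 < r → ∀ ε : ℝ, 0 < ε → ∃ K : ℕ, ∀ k ≥ K,
      ∀ t ∈ Icc A B, ∀ u : E, ‖u‖ ≤ r → ‖hk k t u - h t u‖ ≤ ε)
    (hlip : ∀ k, ∀ t ∈ Icc A B, ∀ u v : E, ‖hk k t u - hk k t v‖ ≤ ‖u - v‖)
    (hφ : ∀ k, ∀ t ∈ Icc A B, ∀ u v : E, ‖hk k t u - hk k t v‖ ≤ φ k ‖u - v‖)
    (hreg : ∀ k (v : E), RegulatedOn (fun t => hk k t v) A B)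
    (hunif : ∀ c d : ℝ, 0 < c → c < d → ∃ δ > (0 : ℝ), ∀ k : ℕ, ∀ t ∈ Icc c d, φ k t < t - δ)
    (hΓ : MonotoneOn Γ (Icc A B))
    (hI : ∀ k, ∀ s ∈ Icc A B, ∀ t ∈ Icc A B, ‖I k t - I k s‖ ≤ |Γ t - Γ s|)
    (hx : ∀ k, ∀ t ∈ Icc A B, x k t = xhat k - hk k A (xhat k) + hk k t (x k t) + I k t)
    {r : ℝ} {K₀ : ℕ} (hb : ∀ k ≥ K₀, ∀ t ∈ Icc A B, ‖x k t‖ ≤ r)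
    {l : Filter ℝ} (hl : l ∈ sideFilters A B) {ε : ℝ} (hε : 0 < ε) :
    ∃ S ∈ l, ∃ K, ∀ k ≥ K, ∀ s ∈ S, ∀ t ∈ S, ‖x k s - x k t‖ ≤ ε := by
  have hr : 0 ≤ r := (norm_nonneg _).trans (hb K₀ le_rfl A (left_mem_Icc.2 hAB))
  obtain ⟨δ, hδ, hδ'⟩ := hunif ε (2 * r + ε + 1) hε (by linarith)
  obtain ⟨K, hK⟩ := hlim (r + 1) (by positivity) (δ / 4) (by positivity)
  obtain ⟨S, hS, hSI, hS'⟩ := exists_norm_sub_le_of_lipschitz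
    (fun t ht => norm_limit_sub_le hlim hlip ht) (regulatedOn_limit hlim hreg) hl r
    (show 0 < δ / 4 by positivity)
  obtain ⟨T, hT, hT'⟩ := (regulatedOn_of_monotoneOn hAB hΓ).exists_norm_sub_le hl
    (show 0 < δ / 4 by positivity)
  refine ⟨S ∩ T, inter_mem hS hT, max K K₀, fun k hk' s hs t ht => ?_⟩
  by_contra! hlt
  have hsI := hSI hs.1
  have htI := hSI ht.1
  have hkK := (le_max_left _ _).trans hk'
  have hxs := hb k ((le_max_right _ _).trans hk') s hsI
  have hxt := hb k ((le_max_right _ _).trans hk') t htI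
  have h1 := hδ' k ‖x k s - x k t‖ ⟨hlt.le, by linarith [norm_sub_le (x k s) (x k t)]⟩
  have h2 := hφ k s hsI (x k s) (x k t)
  have h3 := hS' s hs.1 t ht.1 (x k t) hxt
  have h4 := hK k hkK s hsI (x k t) (by linarith)
  have h5 := hK k hkK t htI (x k t) (by linarith)
  have h6 := hI k t htI s hsI
  have h7 := hT' s hs.2 t ht.2
  rw [Real.norm_eq_abs] at h7
  have e : x k s - x k t = (hk k s (x k s) - hk k s (x k t)) + (hk k s (x k t) - h s (x k t)) +
      (h s (x k t) - h t (x k t)) + -(hk k t (x k t) - h t (x k t)) + (I k s - I k t) := by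
    refine (congrArg₂ (· - ·) (hx k s hsI) (hx k t htI)).trans ?_
    abel
  have h8 : ‖x k s - x k t‖ ≤ ‖hk k s (x k s) - hk k s (x k t)‖ +
      ‖hk k s (x k t) - h s (x k t)‖ + ‖h s (x k t) - h t (x k t)‖ +
      ‖hk k t (x k t) - h t (x k t)‖ + ‖I k s - I k t‖ := by
    nth_rw 1 [e]
    refine (norm_add_le _ _).trans (add_le_add_left ?_ _)
    refine (norm_add_le _ _).trans ?_
    rw [norm_neg]
    exact add_le_add_left norm_add₃_le _
  linarith

end Hybrid

section IntegralBounds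

open MeasureTheory

variable {E : Type*} [NormedAddCommGroup E] [NormedSpace ℝ E] {μ : Measure ℝ} {A B : ℝ}

lemma integral_Ico_sub_integral_Ico {F : ℝ → E} (hF : IntegrableOn F (Ico A B) μ) {s t : ℝ}
    (hs : A ≤ s) (hst : s ≤ t) (ht : t ≤ B) :
    ∫ y in Ico A t, F y ∂μ - ∫ y in Ico A s, F y ∂μ = ∫ y in Ico s t, F y ∂μ := by
  rw [← Ico_union_Ico_eq_Ico hs hst, setIntegral_union
    (Ico_disjoint_Ico_same) measurableSet_Ico
    (hF.mono_set (Ico_subset_Ico_right (hst.trans ht))) (hF.mono_set (Ico_subset_Ico hs ht)),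
    add_sub_cancel_left]

lemma norm_integral_Ico_sub_le {F : ℝ → E} {ρ : ℝ → ℝ} (hF : IntegrableOn F (Ico A B) μ)
    (hρ : Integrable ρ μ) (hle : ∀ᵐ t ∂μ, t ∈ Ico A B → ‖F t‖ ≤ ρ t) {s t : ℝ}
    (hs : s ∈ Icc A B) (ht : t ∈ Icc A B) :
    ‖∫ y in Ico A t, F y ∂μ - ∫ y in Ico A s, F y ∂μ‖ ≤
      |∫ y in Ico A t, ρ y ∂μ - ∫ y in Ico A s, ρ y ∂μ| := by
  have key : ∀ s ∈ Icc A B, ∀ t ∈ Icc A B, s ≤ t →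
      ‖∫ y in Ico A t, F y ∂μ - ∫ y in Ico A s, F y ∂μ‖ ≤
        |∫ y in Ico A t, ρ y ∂μ - ∫ y in Ico A s, ρ y ∂μ| := by
    intro s hs t ht hst
    rw [integral_Ico_sub_integral_Ico hF hs.1 hst ht.2,
      integral_Ico_sub_integral_Ico hρ.integrableOn hs.1 hst ht.2]
    refine le_trans (norm_integral_le_of_norm_le hρ.integrableOn ?_) (le_abs_self _)
    refine (ae_restrict_iff' measurableSet_Ico).2 ?_
    filter_upwards [hle] with y hy hy'
    exact hy (Ico_subset_Ico hs.1 ht.2 hy')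
  rcases le_total s t with h | h
  · exact key s hs t ht h
  · rw [norm_sub_rev, abs_sub_comm]
    exact key t ht s hs h

lemma monotoneOn_integral_Ico {ρ : ℝ → ℝ} (hρ : Integrable ρ μ) (h0 : ∀ t, 0 ≤ ρ t) :
    MonotoneOn (fun t => ∫ y in Ico A t, ρ y ∂μ) (Icc A B) := fun _ _ _ _ hst =>
  setIntegral_mono_set hρ.integrableOn (ae_of_all _ h0)
    (ae_of_all _ fun _ hy => Ico_subset_Ico_right hst hy)

/-- Dominated convergence for the integrals over `[A, t)`. -/
lemma tendsto_integral_Ico_of_dominated {F : ℕ → ℝ → E} {F' : ℝ → E} {ρ : ℝ → ℝ}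
    (hF : ∀ k, IntegrableOn (F k) (Ico A B) μ) (hρ : Integrable ρ μ)
    (hle : ∀ k, ∀ᵐ t ∂μ, t ∈ Ico A B → ‖F k t‖ ≤ ρ t)
    (hlim : ∀ t ∈ Icc A B, Tendsto (fun k => F k t) atTop (𝓝 (F' t))) :
    IntegrableOn F' (Ico A B) μ ∧ ∀ t ∈ Icc A B,
      Tendsto (fun k => ∫ y in Ico A t, F k y ∂μ) atTop (𝓝 (∫ y in Ico A t, F' y ∂μ)) := by
  constructor
  · have hlim' : ∀ᵐ t ∂μ.restrict (Ico A B), Tendsto (fun k => F k t) atTop (𝓝 (F' t)) :=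
      (ae_restrict_iff' measurableSet_Ico).2 (ae_of_all _ fun t ht =>
        hlim t (Ico_subset_Icc_self ht))
    refine hρ.restrict.mono' (aestronglyMeasurable_of_tendsto_ae atTop
      (fun k => (hF k).aestronglyMeasurable) hlim') ?_
    filter_upwards [hlim', ae_all_iff.2 fun k => (ae_restrict_iff' measurableSet_Ico).2 (hle k)]
      with t ht ht'
    exact le_of_tendsto ht.norm (Eventually.of_forall ht')
  · intro t ht
    have hsub : Ico A t ⊆ Ico A B := Ico_subset_Ico_right ht.2
    refine tendsto_integral_of_dominated_convergence ρ
      (fun k => ((hF k).mono_set hsub).aestronglyMeasurable) hρ.integrableOn (fun k => ?_) ?_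
    · refine (ae_restrict_iff' measurableSet_Ico).2 ?_
      filter_upwards [hle k] with y hy hy' using hy (hsub hy')
    · exact (ae_restrict_iff' measurableSet_Ico).2 (ae_of_all _ fun y hy =>
        hlim y (Ico_subset_Icc_self (hsub hy)))

end IntegralBounds

section Subsequence

/-- Passing to a subsequence along which `φ k` is strictly sublinear with a common factor. -/
lemma exists_subseq_le_mul {φ : ℕ → ℝ → ℝ} (hlt : ∀ k t, 0 < t → φ k t < t) {R : ℝ} (hR : 0 < R)
    (hliminf : liminf (fun k => sSup ((fun r => φ k r / r) '' Ici R)) atTop < 1) :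
    ∃ q < 1, ∃ ψ : ℕ → ℕ, StrictMono ψ ∧ ∀ k, ∀ r ≥ R, φ (ψ k) r ≤ q * r := by
  have hle : ∀ k, ∀ v ∈ (fun r => φ k r / r) '' Ici R, v ≤ 1 := by
    rintro k _ ⟨r, hr, rfl⟩
    have hr0 : 0 < r := hR.trans_le hr
    exact (div_le_one hr0).2 (hlt k r hr0).le
  obtain ⟨q, hq, hq1⟩ := exists_between hliminf
  have hbdd : IsBoundedUnder (· ≤ ·) atTop
      fun k => sSup ((fun r => φ k r / r) '' Ici R) :=
    isBoundedUnder_of ⟨1, fun k => csSup_le (nonempty_Ici.image _) (hle k)⟩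
  obtain ⟨ψ, hψ, hψ'⟩ := extraction_of_frequently_atTop
    (frequently_lt_of_liminf_lt hbdd.isCoboundedUnder_ge hq)
  refine ⟨q, hq1, ψ, hψ, fun k r hr => ?_⟩
  rw [← div_le_iff₀ (hR.trans_le hr)]
  exact (le_csSup ⟨1, hle (ψ k)⟩ (mem_image_of_mem _ hr)).trans (hψ' k).le

variable {E : Type*} [NormedAddCommGroup E]

/-- Continuous convergence from uniform convergence on bounded sets. -/
lemma tendsto_apply_of_uniform_on_bounded {f : E → E} {fk : ℕ → E → E}
    (hlim : ∀ r : ℝ, 0 < r → ∀ ε : ℝ, 0 < ε → ∃ K : ℕ, ∀ k ≥ K, ∀ u : E, ‖u‖ ≤ r →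
      ‖fk k u - f u‖ ≤ ε)
    {y : ℕ → E} {y₀ : E} (hy : Tendsto y atTop (𝓝 y₀)) (hf : ContinuousAt f y₀) :
    Tendsto (fun k => fk k (y k)) atTop (𝓝 (f y₀)) := by
  have h1 : Tendsto (fun k => f (y k)) atTop (𝓝 (f y₀)) := hf.tendsto.comp hy
  have h2 : Tendsto (fun k => fk k (y k) - f (y k)) atTop (𝓝 0) := by
    rw [Metric.tendsto_atTop]
    intro ε hε
    obtain ⟨K, hK⟩ := hlim (‖y₀‖ + 1) (by positivity) (ε / 2) (by positivity)
    obtain ⟨K', hK'⟩ := Metric.tendsto_atTop.1 hy 1 one_pos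
    refine ⟨max K K', fun k hk => ?_⟩
    have e1 := hK' k ((le_max_right _ _).trans hk)
    rw [dist_eq_norm] at e1
    have e2 := norm_le_norm_add_norm_sub' (y k) y₀
    have e3 := hK k ((le_max_left _ _).trans hk) (y k) (by linarith)
    rw [dist_zero_right]
    linarith
  simpa using h2.add h1

end Subsequence

open MeasureTheory

/-- Theorem 5.1: continuous dependence on parameters. -/
theorem continuous_dependence_on_parameters
    {n : ℕ} (t₀ a : ℝ) (ha : 0 < a)
    (g : ℝ → ℝ) (hg_mono : MonotoneOn g (Set.Icc t₀ (t₀ + a)))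
    (hg_lc : LeftContinuousOn g t₀ (t₀ + a))
    (h f : ℝ → En n → En n) (x₀ : En n)
    (A0 : ∀ t ∈ Set.Icc t₀ (t₀ + a), Continuous (f t))
    (A1 : ∀ u : En n, KSIntegrable (fun s => f s u) g t₀ (t₀ + a))
    (hk fk : ℕ → ℝ → En n → En n) (φk : ℕ → ℝ → ℝ) (Mk : ℕ → ℝ → ℝ)
    (A0k : ∀ k : ℕ, ∀ t ∈ Set.Icc t₀ (t₀ + a), Continuous (fk k t))
    (A1k : ∀ k : ℕ, ∀ u : En n, KSIntegrable (fun s => fk k s u) g t₀ (t₀ + a))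
    (Mk_nonneg : ∀ k : ℕ, ∀ s ∈ Set.Icc t₀ (t₀ + a), 0 ≤ Mk k s)
    (Mk_int : ∀ k : ℕ, KSIntegrable (Mk k) g t₀ (t₀ + a))
    (A2k : ∀ k : ℕ, ∀ (u : En n) (c d : ℝ), t₀ ≤ c → c ≤ d → d ≤ t₀ + a →
      ∀ (If : En n) (Im : ℝ), HasKSIntegral (fun s => fk k s u) g c d If →
        HasKSIntegral (Mk k) g c d Im → ‖If‖ ≤ Im)
    (hφkD : ∀ k : ℕ, IsDFunction (φk k))
    (hφklt : ∀ k : ℕ, ∀ t : ℝ, 0 < t → φk k t < t)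
    (A3k_reg : ∀ k : ℕ, ∀ v : En n, RegulatedOn (fun t => hk k t v) t₀ (t₀ + a))
    (A3k_lip : ∀ k : ℕ, ∀ t ∈ Set.Icc t₀ (t₀ + a), ∀ u v : En n,
      ‖hk k t u - hk k t v‖ ≤ φk k ‖u - v‖)
    (condI : ∀ c d : ℝ, 0 < c → c < d → ∃ δ > (0 : ℝ), ∀ k : ℕ, ∀ t ∈ Set.Icc c d,
      φk k t < t - δ)
    (xhat : ℕ → En n)
    (h_i : Filter.Tendsto xhat Filter.atTop (nhds x₀))
    (h_ii : ∀ r : ℝ, 0 < r → ∀ ε : ℝ, 0 < ε → ∃ K : ℕ, ∀ k ≥ K,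
      ∀ t ∈ Set.Icc t₀ (t₀ + a), ∀ u : En n, ‖u‖ ≤ r → ‖hk k t u - h t u‖ ≤ ε)
    (h_iii₁ : ∀ t ∈ Set.Icc t₀ (t₀ + a), ∀ r : ℝ, 0 < r → ∀ ε : ℝ, 0 < ε → ∃ K : ℕ,
      ∀ k ≥ K, ∀ u : En n, ‖u‖ ≤ r → ‖fk k t u - f t u‖ ≤ ε)
    (h_iii₂ : ∀ s ∈ Set.Icc t₀ (t₀ + a),
      ∃ L : ℝ, Filter.Tendsto (fun k => Mk k s) Filter.atTop (nhds L))
    (C : ℝ) (hC : 0 < C)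
    (h_iii₃ : ∀ (l : ℕ) (σ : ℕ → ℝ) (m : ℕ → ℕ) (I : ℕ → ℝ), 0 < l →
      σ 0 = t₀ → σ l = t₀ + a → (∀ j < l, σ j < σ (j + 1)) →
      (∀ j < l, HasKSIntegral (Mk (m j)) g (σ j) (σ (j + 1)) (I j)) →
      ∑ j ∈ Finset.range l, I j ≤ C)
    (xk : ℕ → ℝ → En n)
    (hxk : ∀ k : ℕ, IsHMDESolution (hk k) (fk k) g t₀ a (xhat k) (xk k))
    (R : ℝ) (hR : 0 < R)
    (hliminf : Filter.liminf
      (fun k => sSup ((fun r => φk k r / r) '' Set.Ici R)) Filter.atTop < 1) :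
    ∃ ψ : ℕ → ℕ, StrictMono ψ ∧ ∃ x : ℝ → En n,
      IsHMDESolution h f g t₀ a x₀ x ∧
      TendstoUniformlyOn (fun j => xk (ψ j)) x Filter.atTop (Set.Icc t₀ (t₀ + a)) := by
  set b := t₀ + a with hb
  have hAB : t₀ < b := by linarith
  have hA : t₀ ∈ Icc t₀ b := left_mem_Icc.2 hAB.le
  obtain ⟨g', μ, hμfin, hg', hgg', hμ⟩ := exists_measure_Ico hAB hg_mono hg_lc
  have hsub : ∀ {c d t}, t₀ ≤ c → d ≤ b → t ∈ Icc c d → t ∈ Icc t₀ b :=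
    fun hc hd ht => ⟨hc.trans ht.1, ht.2.trans hd⟩
  have hnn : ∀ k c d, t₀ ≤ c → c ≤ d → d ≤ b → ∀ I, HasKSIntegral (Mk k) g c d I → 0 ≤ I := by
    intro k c d hc hcd hd I hI
    obtain ⟨J, hJ⟩ := (A1k k 0).mono hc hcd hd
    exact (norm_nonneg J).trans (A2k k 0 c d hc hcd hd J I hJ hI)
  obtain ⟨G, hG, hGle⟩ := exists_monotoneOn_integral_le hAB Mk_int hnn h_iii₃
  obtain ⟨ρ, hρ, hρ0, hρle⟩ := exists_integrable_dominator (f := fk) hAB hg' hμ hG A0k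
    (fun k u => (A1k k u).imp fun I hI => hI.congr_right hgg')
    (fun k u c d hc hcd hd I hI => by
      obtain ⟨J, hJ⟩ := (Mk_int k).mono hc hcd hd
      exact (A2k k u c d hc hcd hd I J
        (hI.congr_right fun t ht => (hgg' t (hsub hc hd ht)).symm) hJ).trans
        (hGle k c d hc hcd hd J hJ))
  set Γ : ℝ → ℝ := fun t => ∫ y in Ico t₀ t, ρ y ∂μ with hΓdef
  have hΓ : MonotoneOn Γ (Icc t₀ b) := monotoneOn_integral_Ico hρ hρ0
  have hle : ∀ k, ∀ᵐ t ∂μ, t ∈ Ico t₀ b → ‖fk k t (xk k t)‖ ≤ ρ t := fun k => by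
    filter_upwards [hρle] with t ht htI using ht htI k _
  choose hxreg hx0 hhreg I hI hxeq using hxk
  have hint : ∀ k, IntegrableOn (fun t => fk k t (xk k t)) (Ico t₀ b) μ := fun k =>
    integrableOn_of_ksIntegrable hAB hg' hμ
      ⟨_, (hI k b (right_mem_Icc.2 hAB.le)).congr_right hgg'⟩ hρ (hle k)
  have hIeq : ∀ k, ∀ t ∈ Icc t₀ b, I k t = ∫ y in Ico t₀ t, fk k y (xk k y) ∂μ := by
    intro k t ht
    exact ((hI k t ht).congr_right fun s hs => hgg' s (hsub le_rfl ht.2 hs)).unique ht.1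
      (hasKSIntegral_of_integrableOn_En hg' hμ ht.1
        ((hint k).mono_set (Ico_subset_Ico_right ht.2)))
  have hIΓ : ∀ k, ∀ s ∈ Icc t₀ b, ∀ t ∈ Icc t₀ b, ‖I k t - I k s‖ ≤ |Γ t - Γ s| := by
    intro k s hs t ht
    rw [hIeq k s hs, hIeq k t ht]
    exact norm_integral_Ico_sub_le (hint k) hρ (hle k) hs ht
  have hlip : ∀ k, ∀ t ∈ Icc t₀ b, ∀ u v : En n, ‖hk k t u - hk k t v‖ ≤ ‖u - v‖ := by
    intro k t ht u v
    refine (A3k_lip k t ht u v).trans ?_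
    rcases (norm_nonneg (u - v)).eq_or_lt with h0 | h0
    · rw [← h0, (hφkD k).2.2.1]
    · exact (hφklt k _ h0).le
  obtain ⟨q, hq, ψ₁, hψ₁, hψ₁q⟩ := exists_subseq_le_mul hφklt hR hliminf
  have h_ii₁ : ∀ r : ℝ, 0 < r → ∀ ε : ℝ, 0 < ε → ∃ K : ℕ, ∀ k ≥ K,
      ∀ t ∈ Icc t₀ b, ∀ u : En n, ‖u‖ ≤ r → ‖hk (ψ₁ k) t u - h t u‖ ≤ ε := by
    intro r hr ε hε
    obtain ⟨K, hK⟩ := h_ii r hr ε hε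
    exact ⟨K, fun k hkK => hK _ (hkK.trans hψ₁.le_apply)⟩
  obtain ⟨r, K₀, hbound⟩ := exists_norm_solution_le (x := fun k => xk (ψ₁ k))
    (I := fun k => I (ψ₁ k)) hAB.le h_ii₁ (fun k => hlip (ψ₁ k)) (fun k => A3k_lip (ψ₁ k))
    (fun k => A3k_reg (ψ₁ k)) (h_i.comp hψ₁.tendsto_atTop) hΓ (fun k => hIΓ (ψ₁ k))
    (fun k => hx0 (ψ₁ k)) (fun k => hxeq (ψ₁ k)) hq hψ₁q
  obtain ⟨ψ₂, hψ₂, x, hx⟩ := exists_subseq_tendstoUniformlyOn hbound fun l hl ε hε =>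
    exists_norm_solution_sub_le (φ := fun k => φk (ψ₁ k)) (I := fun k => I (ψ₁ k))
      (xhat := fun k => xhat (ψ₁ k)) hAB.le h_ii₁
      (fun k => hlip (ψ₁ k)) (fun k => A3k_lip (ψ₁ k)) (fun k => A3k_reg (ψ₁ k))
      (fun c d hc hcd => (condI c d hc hcd).imp fun δ hδ => ⟨hδ.1, fun k => hδ.2 (ψ₁ k)⟩)
      hΓ (fun k => hIΓ (ψ₁ k)) (fun k => hxeq (ψ₁ k)) hbound hl hε
  set ψ := ψ₁ ∘ ψ₂ with hψdef
  have hψ : StrictMono ψ := hψ₁.comp hψ₂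
  have hxψ : TendstoUniformlyOn (fun j => xk (ψ j)) x atTop (Icc t₀ b) := hx
  have hxt : ∀ t ∈ Icc t₀ b, Tendsto (fun j => xk (ψ j) t) atTop (𝓝 (x t)) :=
    fun t ht => hxψ.tendsto_at ht
  have hxapprox : ∀ ε > 0, ∃ N, ∀ j ≥ N, ∀ t ∈ Icc t₀ b, ‖xk (ψ j) t - x t‖ ≤ ε := by
    intro ε hε
    obtain ⟨N, hN⟩ := eventually_atTop.1 (Metric.tendstoUniformlyOn_iff.1 hxψ ε hε)
    refine ⟨N, fun j hj t ht => ?_⟩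
    rw [← dist_eq_norm, dist_comm]
    exact (hN j hj t ht).le
  have hxreg' : RegulatedOn x t₀ b := regulatedOn_of_approx fun ε hε => by
    obtain ⟨N, hN⟩ := hxapprox ε hε
    exact ⟨_, hxreg (ψ N), hN N le_rfl⟩
  have hhx : ∀ ε > 0, ∃ N, ∀ j ≥ N, ∀ t ∈ Icc t₀ b,
      ‖hk (ψ j) t (xk (ψ j) t) - h t (x t)‖ ≤ ε := by
    intro ε hε
    obtain ⟨N, hN⟩ := hxapprox (ε / 2) (by positivity)
    obtain ⟨Cx, hCx⟩ := hxreg'.exists_norm_le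
    obtain ⟨K, hK⟩ := h_ii (|Cx| + 1) (by positivity) (ε / 2) (by positivity)
    refine ⟨max N K, fun j hj t ht => ?_⟩
    have e1 := hN j ((le_max_left _ _).trans hj) t ht
    have e2 := hlip (ψ j) t ht (xk (ψ j) t) (x t)
    have e3 := hK (ψ j) (((le_max_right _ _).trans hj).trans hψ.le_apply) t ht (x t)
      (by linarith [hCx t ht, le_abs_self Cx])
    have := norm_sub_le_norm_sub_add_norm_sub (hk (ψ j) t (xk (ψ j) t)) (hk (ψ j) t (x t))
      (h t (x t))
    linarith
  have hx0' : x t₀ = x₀ := by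
    refine tendsto_nhds_unique (hxt t₀ hA) ?_
    simp only [hx0]
    exact h_i.comp hψ.tendsto_atTop
  have hht : ∀ t ∈ Icc t₀ b,
      Tendsto (fun j => hk (ψ j) t (xk (ψ j) t)) atTop (𝓝 (h t (x t))) := by
    intro t ht
    rw [Metric.tendsto_atTop]
    intro ε hε
    obtain ⟨N, hN⟩ := hhx (ε / 2) (by positivity)
    refine ⟨N, fun j hj => ?_⟩
    rw [dist_eq_norm]
    linarith [hN j hj t ht]
  have hft : ∀ t ∈ Icc t₀ b,
      Tendsto (fun j => fk (ψ j) t (xk (ψ j) t)) atTop (𝓝 (f t (x t))) := by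
    intro t ht
    refine tendsto_apply_of_uniform_on_bounded (fk := fun j => fk (ψ j) t) (fun r hr ε hε => ?_)
      (hxt t ht) (A0 t ht).continuousAt
    obtain ⟨K, hK⟩ := h_iii₁ t ht r hr ε hε
    exact ⟨K, fun j hj => hK _ (hj.trans hψ.le_apply)⟩
  obtain ⟨hFint, hFlim⟩ := tendsto_integral_Ico_of_dominated (fun j => hint (ψ j)) hρ
    (fun j => hle (ψ j)) hft
  refine ⟨ψ, hψ, x, ⟨hxreg', hx0', ?_, fun t => ∫ y in Ico t₀ t, f y (x y) ∂μ, ?_, ?_⟩, hxψ⟩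
  · refine regulatedOn_of_approx fun ε hε => ?_
    obtain ⟨N, hN⟩ := hhx ε hε
    exact ⟨_, hhreg (ψ N), hN N le_rfl⟩
  · intro t ht
    exact (hasKSIntegral_of_integrableOn_En hg' hμ ht.1
      (hFint.mono_set (Ico_subset_Ico_right ht.2))).congr_right
        fun s hs => (hgg' s (hsub le_rfl ht.2 hs)).symm
  · intro t ht
    refine tendsto_nhds_unique (hxt t ht) ?_
    have hxh := h_i.comp hψ.tendsto_atTop
    have h0 := hht t₀ hA
    simp only [hx0, hx0'] at h0
    refine (((hxh.sub h0).add (hht t ht)).add (hFlim t ht)).congr fun j => ?_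
    rw [← hIeq (ψ j) t ht]
    exact (hxeq (ψ j) t ht).symm

end HMDEPaper
end

section
/- Let (a_n)_{n≥0} be a bounded sequence of real numbers with a_{n+1} − a_n → 0 as n → ∞. Define x : [0,∞) → ℝ by x(t) = a₁ + (a₁ − a₀)(t − 1) for 0 ≤ t ≤ 1, and x(t) = a_{n+1} + (a_{n+1} − a_{n−1})(t − n − 1) for n < t ≤ n+1, n ∈ ℕ, n ≥ 1. Then: x is bounded on [0,∞); x is regulated on [0,∞), left-continuous at every point, with x(n) = a_n and right limit x(n⁺) = a_{n−1} for every integer n ≥ 1; |x(t+1) − x(t)| ≤ 2|a_{n+2} − a_{n+1}| + |a_n − a_{n−1}| for every t ∈ (n, n+1] with n ≥ 1; and x(t+1) − x(t) → 0 as t → ∞, i.e., x is S-asymptotically 1-periodic. -/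
open Set Filter Topology

namespace HMDEPaper

/-- The half-open unit intervals `(n, n + 1]` cover the positive half-line. -/
theorem exists_nat_lt_le_add_one {t : ℝ} (ht : 0 < t) :
    ∃ n : ℕ, (n : ℝ) < t ∧ t ≤ (n : ℝ) + 1 := by
  obtain ⟨n, hn⟩ := Nat.exists_eq_succ_of_ne_zero (Nat.ceil_pos.mpr ht).ne'
  refine ⟨n, Nat.lt_ceil.mp (by omega), ?_⟩
  have h := Nat.le_ceil t
  rw [hn] at h
  exact_mod_cast h

/-- A function agreeing with a continuous one on `(p, q]` has the same left limit at each
point of `(p, q]`. -/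
theorem tendsto_left_of_eqOn_Ioc {f g : ℝ → ℝ} {p q t : ℝ} (hg : Continuous g)
    (h : EqOn f g (Ioc p q)) (ht : t ∈ Ioc p q) (c : ℝ) :
    Tendsto f (𝓝[Ico c t] t) (𝓝 (f t)) := by
  rw [h ht]
  refine (hg.tendsto t).mono_left nhdsWithin_le_nhds |>.congr' ?_
  filter_upwards [self_mem_nhdsWithin, mem_nhdsWithin_of_mem_nhds (Ioi_mem_nhds ht.1)]
    with s hs hps
  exact (h ⟨hps, hs.2.le.trans ht.2⟩).symm

/-- A function agreeing with a continuous one on `(p, q]` has the same right limit at each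
point of `[p, q)`. -/
theorem tendsto_right_of_eqOn_Ioc {f g : ℝ → ℝ} {p q t : ℝ} (hg : Continuous g)
    (h : EqOn f g (Ioc p q)) (ht : t ∈ Ico p q) :
    Tendsto f (𝓝[>] t) (𝓝 (g t)) := by
  refine (hg.tendsto t).mono_left nhdsWithin_le_nhds |>.congr' ?_
  filter_upwards [self_mem_nhdsWithin, mem_nhdsWithin_of_mem_nhds (Iio_mem_nhds ht.2)]
    with s hs hsq
  exact (h ⟨ht.1.trans_lt hs, le_of_lt hsq⟩).symm

/-- Example 4.1: the piecewise linear interpolation of a bounded sequence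
with vanishing increments is a bounded regulated left-continuous S-asymptotically
`1`-periodic function. -/
theorem example_sap_function
    (a : ℕ → ℝ) (hbdd : ∃ C : ℝ, ∀ n : ℕ, |a n| ≤ C)
    (hdiff : Filter.Tendsto (fun n => a (n + 1) - a n) Filter.atTop (nhds 0))
    (x : ℝ → ℝ)
    (hx0 : ∀ t : ℝ, 0 ≤ t → t ≤ 1 → x t = a 1 + (a 1 - a 0) * (t - 1))
    (hxn : ∀ n : ℕ, 1 ≤ n → ∀ t : ℝ, (n : ℝ) < t → t ≤ (n : ℝ) + 1 →
      x t = a (n + 1) + (a (n + 1) - a (n - 1)) * (t - (n : ℝ) - 1)) :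
    (∃ C : ℝ, ∀ t : ℝ, 0 ≤ t → |x t| ≤ C) ∧
    RegulatedOnIci x ∧
    (∀ t : ℝ, 0 < t → Filter.Tendsto x (nhdsWithin t (Set.Ico 0 t)) (nhds (x t))) ∧
    (∀ n : ℕ, 1 ≤ n → x (n : ℝ) = a n) ∧
    (∀ n : ℕ, 1 ≤ n →
      Filter.Tendsto x (nhdsWithin (n : ℝ) (Set.Ioi (n : ℝ))) (nhds (a (n - 1)))) ∧
    (∀ n : ℕ, 1 ≤ n → ∀ t : ℝ, (n : ℝ) < t → t ≤ (n : ℝ) + 1 →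
      |x (t + 1) - x t| ≤ 2 * |a (n + 2) - a (n + 1)| + |a n - a (n - 1)|) ∧
    Filter.Tendsto (fun t => x (t + 1) - x t) Filter.atTop (nhds 0) := by
  set F : ℕ → ℝ → ℝ := fun n t =>
    a (n + 1) + (a (n + 1) - a (n - 1)) * (t - (n : ℝ) - 1) with hF
  have hFc : ∀ n, Continuous (F n) := fun n => by fun_prop
  have hxF : ∀ n : ℕ, EqOn x (F n) (Ioc (n : ℝ) (n + 1)) := by
    rintro (_ | n) t ⟨h₁, h₂⟩
    · simp only [Nat.cast_zero, zero_add] at h₁ h₂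
      simp [hF, hx0 t h₁.le h₂]
    · exact hxn (n + 1) (by omega) t h₁ h₂
  have hright : ∀ n : ℕ, ∀ t ∈ Ico (n : ℝ) (n + 1), Tendsto x (𝓝[>] t) (𝓝 (F n t)) :=
    fun n t ht => tendsto_right_of_eqOn_Ioc (hFc n) (hxF n) ht
  have hleft : ∀ t : ℝ, 0 < t → Tendsto x (𝓝[Ico 0 t] t) (𝓝 (x t)) := by
    intro t ht
    obtain ⟨n, hn⟩ := exists_nat_lt_le_add_one ht
    exact tendsto_left_of_eqOn_Ioc (hFc n) (hxF n) hn 0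
  have hincr : ∀ n : ℕ, 1 ≤ n → ∀ t : ℝ, (n : ℝ) < t → t ≤ (n : ℝ) + 1 →
      |x (t + 1) - x t| ≤ 2 * |a (n + 2) - a (n + 1)| + |a n - a (n - 1)| := by
    intro n _ t h₁ h₂
    have hsucc : x (t + 1) = F (n + 1) (t + 1) :=
      hxF (n + 1) ⟨by push_cast; linarith, by push_cast; linarith⟩
    have heq : x (t + 1) - x t =
        (a (n + 2) - a (n + 1)) * (t - n) + (a n - a (n - 1)) * (n + 1 - t) := by
      rw [hsucc, hxF n ⟨h₁, h₂⟩]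
      simp only [hF, Nat.add_sub_cancel]
      push_cast
      ring
    rw [heq]
    refine (abs_add_le _ _).trans ?_
    rw [abs_mul, abs_mul, abs_of_nonneg (by linarith : 0 ≤ t - n),
      abs_of_nonneg (by linarith : 0 ≤ (n : ℝ) + 1 - t)]
    nlinarith [abs_nonneg (a (n + 2) - a (n + 1)), abs_nonneg (a n - a (n - 1))]
  refine ⟨?_, ⟨fun t ht => ⟨_, hleft t ht⟩, fun t ht => ⟨_, hright ⌊t⌋₊ t
    ⟨Nat.floor_le ht, Nat.lt_floor_add_one t⟩⟩⟩, hleft, ?_, ?_, hincr, ?_⟩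
  · obtain ⟨C, hC⟩ := hbdd
    have hFb : ∀ (n : ℕ) (t : ℝ), (n : ℝ) ≤ t → t ≤ n + 1 → |F n t| ≤ 3 * C := by
      intro n t h₁ h₂
      have hs : |t - n - 1| ≤ 1 := abs_le.mpr ⟨by linarith, by linarith⟩
      have hd : |a (n + 1) - a (n - 1)| ≤ 2 * C :=
        (abs_sub _ _).trans (by linarith [hC (n + 1), hC (n - 1)])
      calc |F n t| ≤ |a (n + 1)| + |a (n + 1) - a (n - 1)| * |t - n - 1| := by
            rw [← abs_mul]
            exact abs_add_le _ _
        _ ≤ C + 2 * C := add_le_add (hC _)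
            ((mul_le_of_le_one_right (abs_nonneg _) hs).trans hd)
        _ = 3 * C := by ring
    refine ⟨3 * C, fun t ht => ?_⟩
    rcases ht.eq_or_lt with rfl | ht
    · simpa [hF, hx0 0 le_rfl zero_le_one] using hFb 0 0 (by simp) (by simp)
    · obtain ⟨n, h₁, h₂⟩ := exists_nat_lt_le_add_one ht
      rw [hxF n ⟨h₁, h₂⟩]
      exact hFb n t h₁.le h₂
  · intro n hn
    obtain ⟨m, rfl⟩ := Nat.exists_eq_add_of_le' hn
    rw [hxF m ⟨by simp, by simp⟩]
    simp [hF]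
  · intro n _
    convert hright n n ⟨le_rfl, by simp⟩ using 2
    simp [hF]
  · have hmaj : Tendsto (fun k => 2 * |a (k + 3) - a (k + 2)| + |a (k + 1) - a k|)
        atTop (𝓝 0) := by
      simpa using ((hdiff.comp (tendsto_add_atTop_nat 2)).abs.const_mul 2).add hdiff.abs
    rw [Metric.tendsto_atTop] at hmaj ⊢
    intro ε hε
    obtain ⟨N, hN⟩ := hmaj ε hε
    refine ⟨N + 2, fun t ht => ?_⟩
    obtain ⟨n, h₁, h₂⟩ := exists_nat_lt_le_add_one
      (lt_of_lt_of_le (by positivity : (0 : ℝ) < N + 2) ht)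
    have hNn : N + 1 ≤ n := by
      have : (N : ℝ) + 1 ≤ n := by linarith
      exact_mod_cast this
    obtain ⟨k, rfl⟩ := Nat.exists_eq_add_of_le' (show 1 ≤ n by omega)
    have hk := hN k (by omega)
    rw [Real.dist_eq, sub_zero] at hk ⊢
    exact ((hincr (k + 1) (by omega) t h₁ h₂).trans (le_abs_self _)).trans_lt hk

end HMDEPaper
end
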